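/- There is an absolute constant C such that the following holds. Let p be an odd prime, n an integer with 2 ≤ n < p, and A, k integers with |A| < p/2, p ∤ A, 1 ≤ k < p−1 and gcd(k, p−1) = 1, and set d = gcd(k−1, p−1). Then for all i, j with 0 ≤ i, j ≤ n−1, the number of x in I_i whose image f(x) lies in I_j satisfies | |f(I_i) ∩ I_j| − p/n² | ≤ C·( d·(log p)² + p^{89/92}·(log p)² ). -/

import Mathlib

/-- `Iclass p n j` is the residue class `I_j = {x : 1 ≤ x ≤ p-1, x ≡ j (mod n)}`. -/
def Iclass (p n j : ℕ) : Finset ℕ :=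
  (Finset.Icc 1 (p - 1)).filter fun x => x % n = j

/-- `fmap p A k x` is `A x^k mod p`, the least residue in `{0, …, p-1}`
(for `x ∈ I` and `p ∤ A` this is the least positive residue). -/
def fmap (p : ℕ) (A : ℤ) (k : ℕ) (x : ℕ) : ℕ :=
  ((A : ZMod p) * (x : ZMod p) ^ k).val

section

open Polynomial

theorem eq_zero_of_pow_dvd_of_card_support_le {F : Type*} [Field F] {p : ℕ} [CharP F p]
    {r : F} (hr : r ≠ 0) (n : ℕ) :
    ∀ q : F[X], q.natDegree < p → (X - C r) ^ n ∣ q → q.support.card ≤ n → q = 0 := by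
  have key : ∀ k : ℕ, (k : F) = 0 → k < p → k = 0 := fun k hk hkp =>
    Nat.eq_zero_of_dvd_of_lt ((CharP.cast_eq_zero_iff F p k).1 hk) hkp
  induction n with
  | zero => 
    intro q _ _ h
    simpa using h
  | succ n ih =>
    intro q hdeg hdvd hcard
    by_contra hq
    obtain ⟨q1, hq1, hX⟩ := Polynomial.exists_eq_pow_rootMultiplicity_mul_and_not_dvd q hq 0
    simp only [C_0, sub_zero] at hq1 hX
    set a := q.rootMultiplicity 0 with ha
    have hq10 : q1 ≠ 0 := by rintro rfl; simp at hX
    have hcop : IsCoprime ((X - C r) ^ (n + 1)) (X ^ a : F[X]) := by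
      apply IsCoprime.pow
      have := Polynomial.isCoprime_X_sub_C_of_isUnit_sub (R := F) (a := r) (b := 0) (by simpa using hr)
      simpa using this
    have hd1 : (X - C r) ^ (n + 1) ∣ q1 := hcop.dvd_of_dvd_mul_left (hq1 ▸ hdvd)
    have hdeg1 : q1.natDegree < p := by
      rw [hq1, natDegree_X_pow_mul _ hq10] at hdeg
      omega
    have hcard1 : q1.support.card ≤ n + 1 := by
      refine le_trans (Finset.card_le_card_of_injOn (fun k => k + a) ?_ fun x _ y _ h => by
        simpa using h) hcard
      intro k hk
      simp only [Finset.mem_coe, mem_support_iff] at hk ⊢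
      rwa [hq1, coeff_X_pow_mul]
    have hcoeff0 : q1.coeff 0 ≠ 0 := by rwa [Ne, ← Polynomial.X_dvd_iff]
    have hdd : (X - C r) ^ n ∣ derivative q1 := by
      obtain ⟨s, hs⟩ := hd1
      rw [hs, derivative_mul, derivative_X_sub_C_pow]
      refine dvd_add (Dvd.dvd.mul_right (by simp) _) (Dvd.dvd.mul_right (pow_dvd_pow _ (by omega)) _)
    have hcd : (derivative q1).support.card ≤ n := by
      have : (derivative q1).support.map ⟨Nat.succ, Nat.succ_injective⟩ ⊆ q1.support.erase 0 := by
        intro e he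
        simp only [Finset.mem_map, mem_support_iff, Function.Embedding.coeFn_mk] at he
        obtain ⟨e', he', rfl⟩ := he
        rw [coeff_derivative] at he'
        simp only [Finset.mem_erase, mem_support_iff]
        exact ⟨by omega, left_ne_zero_of_mul he'⟩
      have := Finset.card_le_card this
      rw [Finset.card_map, Finset.card_erase_of_mem (by simpa using hcoeff0)] at this
      omega
    have hd0 := ih (derivative q1) (lt_of_le_of_lt (natDegree_derivative_le _) (by omega)) hdd hcd
    have hnd : q1.natDegree = 0 := by
      by_contra hne
      have h1 : (derivative q1).coeff (q1.natDegree - 1) = 0 := by rw [hd0]; simp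
      rw [coeff_derivative, Nat.sub_add_cancel (by omega)] at h1
      rcases mul_eq_zero.1 h1 with h1 | h1
      · simp at h1; exact hq10 h1
      · have : ((q1.natDegree : ℕ) : F) = 0 := by
          rw [← h1]
          have : q1.natDegree = q1.natDegree - 1 + 1 := by omega
          conv_lhs => rw [this]
          push_cast; ring
        exact hne (key _ this hdeg1)
    have := Polynomial.natDegree_le_of_dvd hd1 hq10
    rw [natDegree_pow, natDegree_X_sub_C] at this
    omega

theorem eq_zero_of_pow_dvd_of_card_residue_le {F : Type*} [Field F] {p : ℕ} [CharP F p]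
    {l : ℕ} (hl : 0 < l) {β : F} (hβ : β ≠ 0) (n : ℕ) (Q : F[X])
    (hdeg : ∀ f ∈ Q.support, f < (p - 1) * l)
    (hcard : ∀ e, (Q.support.filter fun f => f % l = e).card ≤ n)
    (hdvd : (1 - C β * X ^ l) ^ n ∣ Q) : Q = 0 := by
  by_contra hQ
  obtain ⟨f, hf⟩ := Polynomial.support_nonempty.2 hQ
  have hlp : 0 < p - 1 := by
    by_contra h
    have := hdeg f hf
    simp_all
  set e := l - 1 - (f + l - 1) % l with he
  have hmodlt := Nat.mod_lt (f + l - 1) hl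
  obtain ⟨k0, hk0⟩ : ∃ k, f + e = k * l := by
    have := Nat.div_add_mod (f + l - 1) l
    exact ⟨(f + l - 1) / l, by rw [mul_comm]; omega⟩
  have helt : e < l := by omega
  have hq : contract l (X ^ e * Q) = 0 := by
    apply eq_zero_of_pow_dvd_of_card_support_le (p := p) (inv_ne_zero hβ) n
    · have : (contract l (X ^ e * Q)).natDegree ≤ p - 1 := by
        rw [natDegree_le_iff_coeff_eq_zero]
        intro N hN
        rw [coeff_contract (by omega), coeff_X_pow_mul']
        split_ifs with h
        · by_contra hne
          have := hdeg _ (mem_support_iff.2 hne)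
          have h2 : (p - 1 + 1) * l ≤ N * l := Nat.mul_le_mul_right _ (by omega)
          rw [add_mul] at h2
          omega
        · rfl
      omega
    · obtain ⟨G, hG⟩ := hdvd
      have h1 : X ^ e * Q = X ^ e * G * expand F l ((1 - C β * X) ^ n) := by
        rw [hG]; simp; ring
      rw [h1, contract_mul_expand (by omega)]
      have h2 : (1 - C β * X) = C (-β) * (X - C β⁻¹) := by
        rw [mul_sub, ← C_mul]; simp [hβ]; ring
      rw [h2, mul_pow]
      exact Dvd.dvd.mul_left (Dvd.intro_left _ rfl) _
    · refine le_trans ?_ (hcard (f % l))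
      apply Finset.card_le_card_of_injOn (fun k => k * l - e)
      · intro k hk
        simp only [Finset.mem_coe, mem_support_iff] at hk
        rw [coeff_contract (by omega), coeff_X_pow_mul'] at hk
        split_ifs at hk with h
        · simp only [Finset.coe_filter, Set.mem_ofPred_eq, mem_support_iff]
          refine ⟨hk, ?_⟩
          have h3 : (k * l - e) + e ≡ f + e [MOD l] := by
            rw [hk0, Nat.sub_add_cancel h]; simp [Nat.ModEq]
          exact Nat.ModEq.add_right_cancel' e h3
        · simp at hk
      · intro k hk k' hk' hkk
        simp only [Finset.mem_coe, mem_support_iff] at hk hk'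
        rw [coeff_contract (by omega), coeff_X_pow_mul'] at hk hk'
        split_ifs at hk hk' with h h' 
        · simp only at hkk
          exact Nat.eq_of_mul_eq_mul_right hl (by omega)
        all_goals simp at hk hk'
  have : (contract l (X ^ e * Q)).coeff k0 = Q.coeff f := by
    rw [coeff_contract (by omega), ← hk0, coeff_X_pow_mul]
  rw [hq, coeff_zero] at this
  exact (mem_support_iff.1 hf) this.symm

theorem X_sub_C_pow_dvd_of_iterate {F : Type*} [Field F] {p : ℕ} [CharP F p] {f : F[X]} {z : F}
    (hf : f.eval z ≠ 0) (M : ℕ) : ∀ G : F[X], M ≤ p →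
    (∀ k < M, (((fun H : F[X] => f * derivative H)^[k]) G).eval z = 0) → (X - C z) ^ M ∣ G := by
  induction M with
  | zero => intro G _ _; simp
  | succ M ih =>
    intro G hM h
    obtain ⟨K, hK⟩ := ih G (by omega) fun k hk => h k (by omega)
    have h1 := ih (f * derivative G) (by omega) fun k hk => by
      simpa using h (k + 1) (by omega)
    rcases Nat.eq_zero_or_pos M with rfl | hM0
    · simpa [dvd_iff_isRoot] using h 0 (by omega)
    have hcop : IsCoprime ((X - C z) ^ M) f := by
      apply IsCoprime.pow_left
      rw [(irreducible_X_sub_C z).coprime_iff_not_dvd, dvd_iff_isRoot]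
      exact hf
    have h2 := hcop.dvd_of_dvd_mul_left h1
    rw [hK, derivative_mul, derivative_X_sub_C_pow] at h2
    have h3 : (X - C z) ^ M ∣ C (M : F) * (X - C z) ^ (M - 1) * K :=
      (dvd_add_left (Dvd.intro _ rfl)).1 h2
    have h4 : (X - C z) ^ (M - 1) * (X - C z) ∣ (X - C z) ^ (M - 1) * (C (M : F) * K) := by
      rw [← pow_succ, Nat.sub_add_cancel hM0]
      convert h3 using 1; ring
    have h5 := (mul_dvd_mul_iff_left (pow_ne_zero _ (X_sub_C_ne_zero z))).1 h4
    have hMF : (M : F) ≠ 0 := fun h0 => by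
      have := Nat.le_of_dvd hM0 ((CharP.cast_eq_zero_iff F p M).1 h0)
      omega
    have h6 : (X - C z) ∣ K := by
      rw [dvd_iff_isRoot] at h5 ⊢
      simpa [hMF] using h5
    rw [hK, pow_succ]
    exact mul_dvd_mul_left _ h6

theorem mul_card_le_natDegree {F : Type*} [Field F] {G : F[X]} (hG : G ≠ 0) (M : ℕ)
    (Z : Finset F) (h : ∀ z ∈ Z, (X - C z) ^ M ∣ G) : M * Z.card ≤ G.natDegree := by
  have h1 : ∏ z ∈ Z, (X - C z) ^ M ∣ G := by
    apply Finset.prod_dvd_of_coprime _ h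
    intro a _ b _ hab
    exact IsCoprime.pow (isCoprime_X_sub_C_of_isUnit_sub (sub_ne_zero.2 hab).isUnit)
  have h2 := natDegree_le_of_dvd h1 hG
  rw [Finset.prod_pow, natDegree_pow, natDegree_prod_of_monic _ _ fun z _ => monic_X_sub_C z] at h2
  simpa using h2

theorem eq_zero_of_sum_mul_pow_eq_zero {R : Type*} [CommRing R] [IsDomain R] {U V : R} (hU : U ≠ 0)
    (I : ℕ) (Q : ℕ → R) (h : ∀ i < I, U ∣ Q i * V ^ (I - 1 - i) → Q i = 0)
    (hsum : ∑ i ∈ Finset.range I, Q i * (U ^ i * V ^ (I - 1 - i)) = 0) : ∀ i < I, Q i = 0 := by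
  intro i
  induction i using Nat.strong_induction_on with
  | _ i ih =>
    intro hi
    apply h i hi
    rw [← Finset.sum_range_add_sum_Ico _ hi.le, Finset.sum_eq_zero (s := Finset.range i),
      zero_add, Finset.sum_eq_sum_Ico_succ_bot hi] at hsum
    · have h1 : U ^ i * U ∣ U ^ i * (Q i * V ^ (I - 1 - i)) := by
        have h2 : U ^ i * U ∣ ∑ k ∈ Finset.Ico (i + 1) I, Q k * (U ^ k * V ^ (I - 1 - k)) := by
          apply Finset.dvd_sum
          intro k hk
          rw [Finset.mem_Ico] at hk
          rw [← pow_succ]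
          exact Dvd.dvd.mul_left (Dvd.dvd.mul_right (pow_dvd_pow _ (by omega)) _) _
        rw [← dvd_add_left h2]
        have : U ^ i * (Q i * V ^ (I - 1 - i)) = Q i * (U ^ i * V ^ (I - 1 - i)) := by ring
        rw [this, hsum]
        exact dvd_zero _
      exact (mul_dvd_mul_iff_left (pow_ne_zero _ hU)).1 h1
    · intro k hk
      rw [Finset.mem_range] at hk
      rw [ih k hk (by omega), zero_mul]

theorem exists_ne_zero_of_card_lt {F ι κ : Type*} [Field F] [Fintype ι] [Fintype κ]
    (A : κ → ι → F) (h : Fintype.card κ < Fintype.card ι) :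
    ∃ c : ι → F, c ≠ 0 ∧ ∀ k, ∑ i, c i * A k i = 0 := by
  classical
  have := LinearMap.ker_ne_bot_of_finrank_lt (f := Matrix.mulVecLin (Matrix.of A)) (by simpa using h)
  obtain ⟨c, hc, hne⟩ := Submodule.exists_mem_ne_zero_of_ne_bot this
  refine ⟨c, hne, fun k => ?_⟩
  have := congrFun (LinearMap.mem_ker.1 hc) k
  simpa [Matrix.mulVec, dotProduct, mul_comm] using this

/-- All exponents of `R` have the form `m * a' + l * b'` with `a' ≤ a` and `b' ≤ b`. -/
def InBox {F : Type*} [Field F] (m l a b : ℕ) (R : F[X]) : Prop :=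
  ∀ e, R.coeff e ≠ 0 → ∃ a' ≤ a, ∃ b' ≤ b, e = m * a' + l * b'

namespace InBox

variable {F : Type*} [Field F] {m l a b a' b' : ℕ} {R S : F[X]}

theorem mono (h : InBox m l a b R) (ha : a ≤ a') (hb : b ≤ b') : InBox m l a' b' R := by
  intro e he
  obtain ⟨x, hx, y, hy, rfl⟩ := h e he
  exact ⟨x, hx.trans ha, y, hy.trans hb, rfl⟩

theorem add (h : InBox m l a b R) (h' : InBox m l a b S) : InBox m l a b (R + S) := by
  intro e he
  by_cases hR : R.coeff e = 0
  · apply h' e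
    simpa [hR] using he
  · exact h e hR

theorem mul (h : InBox m l a b R) (h' : InBox m l a' b' S) :
    InBox m l (a + a') (b + b') (R * S) := by
  intro e he
  rw [coeff_mul] at he
  obtain ⟨x, hx, hne⟩ := Finset.exists_ne_zero_of_sum_ne_zero he
  obtain ⟨a1, ha1, b1, hb1, h1⟩ := h x.1 (left_ne_zero_of_mul hne)
  obtain ⟨a2, ha2, b2, hb2, h2⟩ := h' x.2 (right_ne_zero_of_mul hne)
  refine ⟨a1 + a2, by omega, b1 + b2, by omega, ?_⟩
  rw [← Finset.HasAntidiagonal.mem_antidiagonal.1 hx, h1, h2]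
  ring

theorem const (c : F) : InBox m l 0 0 (C c) := by
  intro e he
  rw [coeff_C] at he
  refine ⟨0, le_rfl, 0, le_rfl, ?_⟩
  by_contra h
  simp_all

theorem X_pow : InBox m l a b (X ^ (m * a + l * b) : F[X]) := by
  intro e he
  rw [coeff_X_pow] at he
  exact ⟨a, le_rfl, b, le_rfl, by by_contra h; simp_all⟩

theorem X_mul_derivative (h : InBox m l a b R) : InBox m l a b (X * derivative R) := by
  intro e he
  rcases e with _ | e
  · simp at he
  · rw [coeff_X_mul, coeff_derivative] at he
    exact h _ (left_ne_zero_of_mul he)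

theorem one_sub_left (c : F) : InBox m l 1 0 (1 - C c * X ^ m) := by
  have h1 : InBox m l 1 0 (C c * X ^ m) := by
    simpa using (const c).mul (X_pow (F := F) (m := m) (l := l) (a := 1) (b := 0))
  have h2 := ((const (F := F) (m := m) (l := l) 1).mono (zero_le_one) le_rfl).add
    ((const (-1)).mul h1)
  convert h2 using 1
  simp [sub_eq_add_neg]

theorem one_sub_right (c : F) : InBox m l 0 1 (1 - C c * X ^ l) := by
  have h1 : InBox m l 0 1 (C c * X ^ l) := by
    simpa using (const c).mul (X_pow (F := F) (m := m) (l := l) (a := 0) (b := 1))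
  have h2 := ((const (F := F) (m := m) (l := l) 1).mono le_rfl (zero_le_one)).add
    ((const (-1)).mul h1)
  convert h2 using 1
  simp [sub_eq_add_neg]

end InBox

/-- The operator induced on `R` by the derivation `y w X d/dX` acting on `X ^ c * y ^ A * w ^ B * R`. -/
noncomputable def twistedOp {F : Type*} [Field F] (y w : F[X]) (A B c : ℕ) (R : F[X]) : F[X] :=
  y * w * (X * derivative R) +
    (C (c : F) * (y * w) + C (A : F) * (w * (X * derivative y)) +
      C (B : F) * (y * (X * derivative w))) * R

section

variable {F : Type*} [Field F]

theorem mul_derivative_pow (f : F[X]) (A : ℕ) :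
    f * derivative (f ^ A) = C (A : F) * f ^ A * derivative f := by
  rcases A with _ | A
  · simp
  · rw [derivative_pow_succ]
    push_cast
    ring

theorem mul_derivative_eq_twistedOp (y w : F[X]) (A B c : ℕ) (R : F[X]) :
    (y * w * X) * derivative (X ^ c * y ^ A * w ^ B * R) =
      X ^ c * y ^ A * w ^ B * twistedOp y w A B c R := by
  have h1 := mul_derivative_pow y A
  have h2 := mul_derivative_pow w B
  have h3 := mul_derivative_pow (X : F[X]) c
  simp only [derivative_mul, twistedOp, derivative_X, mul_one] at h3 ⊢
  linear_combination (X ^ c * w ^ B * R * w * X) * h1 + (X ^ c * y ^ A * R * y * X) * h2 +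
    (y ^ A * w ^ B * R * y * w) * h3

theorem iterate_mul_derivative_eq_twistedOp (y w : F[X]) (A B c : ℕ) (R : F[X]) (k : ℕ) :
    (fun H : F[X] => (y * w * X) * derivative H)^[k] (X ^ c * y ^ A * w ^ B * R) =
      X ^ c * y ^ A * w ^ B * (twistedOp y w A B c)^[k] R := by
  induction k with
  | zero => rfl
  | succ k ih =>
    rw [Function.iterate_succ_apply', Function.iterate_succ_apply', ih,
      mul_derivative_eq_twistedOp]

theorem iterate_mul_derivative_sum (f : F[X]) {ι : Type*} (s : Finset ι) (c : ι → F)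
    (G : ι → F[X]) (k : ℕ) :
    (fun H : F[X] => f * derivative H)^[k] (∑ i ∈ s, C (c i) * G i) =
      ∑ i ∈ s, C (c i) * (fun H : F[X] => f * derivative H)^[k] (G i) := by
  induction k with
  | zero => rfl
  | succ k ih =>
    rw [Function.iterate_succ_apply', ih, derivative_sum, Finset.mul_sum]
    refine Finset.sum_congr rfl fun i _ => ?_
    rw [Function.iterate_succ_apply', derivative_C_mul]
    ring

theorem InBox.twistedOp {m l a b : ℕ} {R : F[X]} (h : InBox m l a b R) (α β : F) (A B c : ℕ) :
    InBox m l (a + 1) (b + 1) (twistedOp (1 - C α * X ^ m) (1 - C β * X ^ l) A B c R) := by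
  have hy := InBox.one_sub_left (m := m) (l := l) α
  have hw := InBox.one_sub_right (m := m) (l := l) β
  have hyw := hy.mul hw
  have h1 := hyw.mul h.X_mul_derivative
  have h2 := (((InBox.const (c : F)).mul hyw).add ((InBox.const (A : F)).mul
    (hw.mul hy.X_mul_derivative))).add ((InBox.const (B : F)).mul (hy.mul hw.X_mul_derivative))
  refine InBox.mono (InBox.add h1 ?_) (by omega) (by omega) 
  exact h2.mul h

theorem InBox.iterate_twistedOp {m l a b : ℕ} {R : F[X]} (h : InBox m l a b R) (α β : F)
    (A B c k : ℕ) : InBox m l (a + k) (b + k)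
      ((_root_.twistedOp (1 - C α * X ^ m) (1 - C β * X ^ l) A B c)^[k] R) := by
  induction k with
  | zero => exact h
  | succ k ih =>
    rw [Function.iterate_succ_apply']
    exact ih.twistedOp α β A B c

/-- The polynomials in a box have few possible exponents. -/
theorem exists_exponents_of_inBox (F : Type*) [Field F] {m l : ℕ} (M : ℕ) (hl : 0 < l)
    (hml : m ≤ l) :
    ∃ E : Finset ℕ, E.card ≤ 4 * (min M l * M) ∧ ∀ (a b : ℕ) (R : F[X]), InBox m l a b R →
      a + 2 ≤ min M l + M → b + 2 ≤ 2 * M → ∀ e, R.coeff e ≠ 0 → e ∈ E := by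
  rcases le_or_gt M l with h | h
  · refine ⟨(Finset.range (2 * M) ×ˢ Finset.range (2 * M)).image fun x => m * x.1 + l * x.2,
      ?_, ?_⟩
    · refine Finset.card_image_le.trans ?_
      rw [Finset.card_product, Finset.card_range, min_eq_left h]
      apply le_of_eq; ring
    · intro a b R hR ha hb e he
      obtain ⟨a', ha', b', hb', rfl⟩ := hR e he
      rw [min_eq_left h] at ha
      simp only [Finset.mem_image, Finset.mem_product, Finset.mem_range, Prod.exists]
      exact ⟨a', b', ⟨by omega, by omega⟩, rfl⟩
  · refine ⟨(Finset.range l ×ˢ Finset.range (4 * M)).image fun x => m * x.1 + l * x.2,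
      ?_, ?_⟩
    · refine Finset.card_image_le.trans ?_
      rw [Finset.card_product, Finset.card_range, Finset.card_range, min_eq_right h.le]
      apply le_of_eq; ring
    · intro a b R hR ha hb e he
      obtain ⟨a', ha', b', hb', rfl⟩ := hR e he
      rw [min_eq_right h.le] at ha
      simp only [Finset.mem_image, Finset.mem_product, Finset.mem_range, Prod.exists]
      have h1 := Nat.div_add_mod a' l
      have h2 := Nat.mod_lt a' hl
      refine ⟨a' % l, m * (a' / l) + b', ⟨h2, ?_⟩, ?_⟩
      · have : m * (a' / l) ≤ l * (a' / l) := Nat.mul_le_mul_right _ hml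
        omega
      · conv_rhs => rw [← h1]
        ring
end

section

variable {F : Type*} [Field F]

/-- Exponents used in the auxiliary polynomial. -/
def auxExponent (m l h : ℕ) {J A M : ℕ} (x : Fin J × Fin A × Fin M) : ℕ :=
  h * x.1 + (m * x.2.1 + l * x.2.2)

theorem auxExponent_lt {m l h J A M : ℕ} (hl : 0 < l) (hE : m * A + l * M ≤ h)
    (x : Fin J × Fin A × Fin M) : m * x.2.1 + l * x.2.2 < h := by
  have h1 : m * x.2.1 ≤ m * A := Nat.mul_le_mul_left _ x.2.1.2.le
  have h2 : l * x.2.2 < l * M := Nat.mul_lt_mul_of_pos_left x.2.2.2 hl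
  omega

theorem eq_of_mod_eq_of_coprime {m l a a' b b' c c' : ℕ} (hcop : Nat.Coprime m l)
    (ha : a < l) (ha' : a' < l) (h : (c + (m * a + l * b)) % l = (c' + (m * a' + l * b')) % l)
    (hc : c = c') : a = a' := by
  subst hc
  have h1 : c + (m * a + l * b) ≡ c + (m * a' + l * b') [MOD l] := h
  have h2 := Nat.ModEq.add_left_cancel' c h1
  have h3 : m * a ≡ m * a' [MOD l] := by
    simpa [Nat.ModEq] using h2
  have h4 := Nat.ModEq.cancel_left_of_coprime (by rwa [Nat.coprime_comm] at hcop) h3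
  exact Nat.ModEq.eq_of_lt_of_lt h4 ha ha'

theorem auxExponent_injective {m l h J A M : ℕ} (hl : 0 < l) (hE : m * A + l * M ≤ h) (hA : A ≤ l)
    (hcop : Nat.Coprime m l) :
    Function.Injective (auxExponent m l h : Fin J × Fin A × Fin M → ℕ) := by
  intro x y hxy
  have hx := auxExponent_lt hl hE x
  have hy := auxExponent_lt hl hE y
  have hh : 0 < h := by omega
  unfold auxExponent at hxy
  have h1 : (x.1 : ℕ) = y.1 := by
    have := congrArg (· / h) hxy
    simpa [Nat.mul_add_div hh, Nat.div_eq_of_lt hx, Nat.div_eq_of_lt hy] using this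
  have h2 : (x.2.1 : ℕ) = y.2.1 :=
    eq_of_mod_eq_of_coprime hcop (x.2.1.2.trans_le hA) (y.2.1.2.trans_le hA)
      (congrArg (· % l) hxy) (by rw [h1])
  have h3 : (x.2.2 : ℕ) = y.2.2 := by
    rw [h1, h2] at hxy
    exact Nat.eq_of_mul_eq_mul_left hl (by omega)
  exact Prod.ext (Fin.ext h1) (Prod.ext (Fin.ext h2) (Fin.ext h3))

theorem coeff_sum_auxExponent {m l h J A M : ℕ} (c : Fin J × Fin A × Fin M → F) (e : ℕ) :
    (∑ x, C (c x) * X ^ auxExponent m l h x : F[X]).coeff e =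
      ∑ x, if e = auxExponent m l h x then c x else 0 := by
  simp [finsetSum_coeff, coeff_X_pow]

theorem exists_of_mem_support_sum {m l h J A M : ℕ} (c : Fin J × Fin A × Fin M → F) {e : ℕ}
    (he : e ∈ (∑ x, C (c x) * X ^ auxExponent m l h x : F[X]).support) :
    ∃ x : Fin J × Fin A × Fin M, e = auxExponent m l h x := by
  rw [mem_support_iff, coeff_sum_auxExponent] at he
  obtain ⟨x, _, hx⟩ := Finset.exists_ne_zero_of_sum_ne_zero he
  exact ⟨x, by by_contra h; simp_all⟩

theorem card_residue_auxExponent {m l h J A M : ℕ} (hA : A ≤ l)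
    (hcop : Nat.Coprime m l) (c : Fin J × Fin A × Fin M → F) (e : ℕ) :
    ((∑ x, C (c x) * X ^ auxExponent m l h x : F[X]).support.filter fun f => f % l = e).card
      ≤ M * J := by
  classical
  have h1 : ((∑ x, C (c x) * X ^ auxExponent m l h x : F[X]).support.filter fun f => f % l = e) ⊆
      (Finset.univ.filter fun x : Fin J × Fin A × Fin M => auxExponent m l h x % l = e).image
        (auxExponent m l h) := by
    intro f hf
    rw [Finset.mem_filter] at hf
    obtain ⟨x, rfl⟩ := exists_of_mem_support_sum c hf.1
    exact Finset.mem_image_of_mem _ (by simpa using hf.2)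
  refine (Finset.card_le_card h1).trans (Finset.card_image_le.trans ?_)
  have h2 : (Finset.univ : Finset (Fin J × Fin M)).card = M * J := by
    simp [mul_comm]
  rw [← h2]
  refine Finset.card_le_card_of_injOn (fun x => (x.1, x.2.2)) (fun _ _ => Finset.mem_univ _) ?_
  intro x hx y hy hxy
  simp only [Finset.coe_filter, Finset.mem_univ, true_and, Set.mem_ofPred_eq] at hx hy
  simp only [Prod.mk.injEq] at hxy
  have h3 : (x.2.1 : ℕ) = y.2.1 :=
    eq_of_mod_eq_of_coprime hcop (x.2.1.2.trans_le hA) (y.2.1.2.trans_le hA) (hx.trans hy.symm)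
      (by rw [hxy.1])
  exact Prod.ext hxy.1 (Prod.ext (Fin.ext h3) hxy.2)

theorem mul_card_le_of_linear_conditions {p : ℕ} [CharP F p] {m l h I J M a₁ a₂ b₁ c₂ D N : ℕ}
    {α β κ : F} {y w : F[X]} (hy : y = 1 - C α * X ^ m) (hw : w = 1 - C β * X ^ l) (hβ : β ≠ 0)
    (hm : 0 < m) (hml : m ≤ l) (hcop : Nat.Coprime m l) (hMp : M ≤ p)
    (hb : M * J ≤ b₁)
    (hIJ : 8 * M < I * J) (hE : m * min M l + l * M ≤ h) (hJ : h * J ≤ (p - 1) * l)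
    (hU : (y ^ a₁ * w ^ b₁).natDegree ≤ D) (hV : (y ^ a₂ * X ^ c₂).natDegree ≤ D)
    (L : Fin N → F[X] →ₗ[F] F) (hN : 2 * N ≤ J * (min M l * M))
    (hL : ∀ Q i, (∀ k, L k Q = 0) → w ^ (M * J) ∣ Q * (y ^ a₂ * X ^ c₂) ^ i → w ^ (M * J) ∣ Q)
    (Z : Finset F) (hZ : ∀ z ∈ Z, z ^ h = 1 ∧ y.eval z ≠ 0 ∧ w.eval z ≠ 0 ∧
      (y ^ a₁ * w ^ b₁).eval z = κ * (y ^ a₂ * X ^ c₂).eval z) :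
    M * Z.card ≤ (I - 1) * D + (m * min M l + l * M) + h * (J - 1) := by
  classical
  rcases Nat.eq_zero_or_pos M with rfl | hM
  · simp
  have hl : 0 < l := by omega
  set A := min M l with hA
  have hA0 : 0 < A := by omega
  have hAl : A ≤ l := min_le_right _ _
  have hI : 0 < I := by by_contra h0; simp_all
  obtain ⟨E, hEcard, hEmem⟩ := exists_exponents_of_inBox F M hl hml
  let ι := Fin I × Fin J × Fin A × Fin M
  let op : ι → F[X] → F[X] := fun x => twistedOp y w (a₁ * x.1 + a₂ * (I - 1 - x.1)) (b₁ * x.1)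
    (h * x.2.1 + c₂ * (I - 1 - x.1))
  let mon : ι → ℕ := fun x => m * x.2.2.1 + l * x.2.2.2
  let T : F[X] → F[X] := fun H => (y * w * X) * derivative H
  let cond : (Fin M × E) ⊕ (Fin I × Fin N) → ι → F := Sum.elim
    (fun k x => κ ^ (x.1 : ℕ) * ((op x)^[k.1] (X ^ mon x)).coeff k.2)
    (fun k x => if x.1 = k.1 then L k.2 (X ^ auxExponent m l h x.2) else 0)
  obtain ⟨c, hc0, hc⟩ := exists_ne_zero_of_card_lt cond (by
    simp only [Fintype.card_sum, Fintype.card_prod, Fintype.card_fin, Fintype.card_coe, ι]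
    have h1 : M * E.card ≤ M * (4 * (A * M)) := Nat.mul_le_mul_left _ hEcard
    have h2 : I * (2 * N) ≤ I * (J * (A * M)) := Nat.mul_le_mul_left _ hN
    have h3 : 8 * M * (A * M) < I * J * (A * M) := Nat.mul_lt_mul_of_pos_right hIJ (by positivity)
    nlinarith)
  set U := y ^ a₁ * w ^ b₁ with hUdef
  set V := y ^ a₂ * X ^ c₂ with hVdef
  let Q : Fin I → F[X] := fun i => ∑ x, C (c (i, x)) * X ^ auxExponent m l h x
  let G : ι → F[X] := fun x => X ^ auxExponent m l h x.2 * (U ^ (x.1 : ℕ) * V ^ (I - 1 - x.1))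
  let P : F[X] := ∑ x, C (c x) * G x
  have hG : ∀ x, G x = X ^ (h * x.2.1 + c₂ * (I - 1 - x.1)) *
      y ^ (a₁ * x.1 + a₂ * (I - 1 - x.1)) * w ^ (b₁ * x.1) * X ^ mon x := by
    intro x
    simp only [G, hUdef, hVdef, auxExponent, mon, mul_pow, pow_add, pow_mul]
    ring
  have hPQ : P = ∑ i : Fin I, Q i * (U ^ (i : ℕ) * V ^ (I - 1 - i)) := by
    simp only [P, Q, ι, G]
    rw [Fintype.sum_prod_type]
    refine Finset.sum_congr rfl fun i _ => ?_
    rw [Finset.sum_mul]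
    refine Finset.sum_congr rfl fun x _ => ?_
    ring
  have hevalC : ∀ (f : F[X]) (r : F) (n : ℕ), f = 1 - C r * X ^ n → f.eval 0 = 1 ∨ n = 0 := by
    rintro f r n rfl
    rcases n with _ | n
    · simp
    · left; simp
  have hy0 : y ≠ 0 := by
    rintro h0
    rcases hevalC y α m hy with h1 | h1
    · simp [h0] at h1
    · omega
  have hw0 : w ≠ 0 := by
    rintro h0
    rcases hevalC w β l hw with h1 | h1
    · simp [h0] at h1
    · omega
  have hQL : ∀ i k, L k (Q i) = 0 := by
    intro i k
    have h1 := hc (Sum.inr (i, k))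
    simp only [cond, Sum.elim_inr, ι, mul_ite, mul_zero] at h1
    rw [Fintype.sum_prod_type, Finset.sum_eq_single i] at h1
    · simp only [if_true] at h1
      simp only [Q, map_sum, ← smul_eq_C_mul, map_smul, smul_eq_mul]
      exact h1
    · intro b _ hb
      simp [hb]
    · simp
  have hP0 : P ≠ 0 := by
    intro hP
    have hQ0 : ∀ i : Fin I, Q i = 0 := by
      have h1 := eq_zero_of_sum_mul_pow_eq_zero (U := U) (V := V)
        (mul_ne_zero (pow_ne_zero _ hy0) (pow_ne_zero _ hw0)) I
        (fun i => if hi : i < I then Q ⟨i, hi⟩ else 0) ?_ ?_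
      · intro i
        simpa using h1 i i.2
      · intro i hi hdvd
        simp only [hi, dif_pos] at hdvd ⊢
        have h2 : w ^ (M * J) ∣ Q ⟨i, hi⟩ := by
          refine hL _ (I - 1 - i) (hQL _) (dvd_trans ?_ hdvd)
          exact (pow_dvd_pow _ hb).trans (Dvd.intro_left _ rfl)
        refine eq_zero_of_pow_dvd_of_card_residue_le (p := p) hl hβ (M * J) _ ?_
          (card_residue_auxExponent hAl hcop _) (hw ▸ h2)
        intro f hf
        obtain ⟨x, rfl⟩ := exists_of_mem_support_sum _ hf
        have h3 := auxExponent_lt hl hE x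
        have h4 : h * (x.1 + 1) ≤ h * J := Nat.mul_le_mul_left _ x.1.2
        unfold auxExponent
        rw [mul_add] at h4
        omega
      · rw [← hP, hPQ, Finset.sum_range]
        simp
    apply hc0
    funext x
    have h1 := congrArg (fun q => q.coeff (auxExponent m l h x.2)) (hQ0 x.1)
    simp only [Q, coeff_sum_auxExponent, coeff_zero] at h1
    rw [Finset.sum_eq_single x.2] at h1
    · simpa using h1
    · intro b _ hb
      rw [if_neg]
      exact fun h2 => hb (auxExponent_injective hl hE hAl hcop h2).symm
    · simp
  have hdvd : ∀ z ∈ Z, (X - C z) ^ M ∣ P := by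
    intro z hz
    obtain ⟨hz1, hzy, hzw, hzUV⟩ := hZ z hz
    have hz0 : z ≠ 0 := by
      rintro rfl
      have : h ≠ 0 := by
        have : 0 < l * M := by positivity
        omega
      simp [this] at hz1
    refine X_sub_C_pow_dvd_of_iterate (p := p) (f := y * w * X) (by simp [hz0, hzy, hzw]) M P hMp ?_
    intro k hk
    simp only [P]
    rw [iterate_mul_derivative_sum, eval_finsetSum]
    have h1 : ∀ x : ι, (C (c x) * (fun H => y * w * X * derivative H)^[k] (G x)).eval z =
        V.eval z ^ (I - 1) * (C (c x * κ ^ (x.1 : ℕ)) * (op x)^[k] (X ^ mon x)).eval z := by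
      intro x
      rw [hG, iterate_mul_derivative_eq_twistedOp]
      simp only [eval_mul, eval_C, eval_pow, eval_X, op]
      have h2 : z ^ (h * (x.2.1 : ℕ) + c₂ * (I - 1 - x.1)) *
          y.eval z ^ (a₁ * (x.1 : ℕ) + a₂ * (I - 1 - x.1)) * w.eval z ^ (b₁ * (x.1 : ℕ)) =
          V.eval z ^ (I - 1) * κ ^ (x.1 : ℕ) := by
        have h3 : I - 1 = x.1 + (I - 1 - x.1) := by
          have := x.1.2
          omega
        calc _ = U.eval z ^ (x.1 : ℕ) * V.eval z ^ (I - 1 - x.1) := by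
              simp only [hUdef, hVdef, eval_mul, eval_pow, eval_X, pow_add, pow_mul, mul_pow, hz1,
                one_pow]
              ring
          _ = V.eval z ^ (x.1 + (I - 1 - x.1)) * κ ^ (x.1 : ℕ) := by
              rw [hzUV, mul_pow, pow_add]
              ring
          _ = _ := by rw [← h3]
      rw [h2]
      ring
    rw [Finset.sum_congr rfl fun x _ => h1 x, ← Finset.mul_sum, ← eval_finsetSum]
    have h4 : ∑ x : ι, C (c x * κ ^ (x.1 : ℕ)) * (op x)^[k] (X ^ mon x) = 0 := by
      ext e
      rw [coeff_zero, finsetSum_coeff]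
      by_cases he : e ∈ E
      · have := hc (Sum.inl (⟨k, hk⟩, ⟨e, he⟩))
        simp only [cond, Sum.elim_inl] at this
        rw [← this]
        refine Finset.sum_congr rfl fun x _ => ?_
        rw [coeff_C_mul, mul_assoc]
      · refine Finset.sum_eq_zero fun x _ => ?_
        rw [coeff_C_mul]
        have hbox : InBox m l (x.2.2.1 + k) (x.2.2.2 + k) ((op x)^[k] (X ^ mon x)) := by
          simp only [op, mon, hy, hw]
          exact InBox.iterate_twistedOp InBox.X_pow α β _ _ _ k
        have h5 : ((op x)^[k] (X ^ mon x)).coeff e = 0 := by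
          by_contra hne
          have := x.2.2.1.2
          have := x.2.2.2.2
          exact he (hEmem _ _ _ hbox (by omega) (by omega) e hne)
        rw [h5, mul_zero]
    rw [h4]
    simp
  refine (mul_card_le_natDegree hP0 M Z hdvd).trans ?_
  rw [hPQ]
  refine natDegree_sum_le_of_forall_le _ _ fun i _ => ?_
  have hQdeg : (Q i).natDegree ≤ (m * A + l * M) + h * (J - 1) := by
    refine natDegree_sum_le_of_forall_le _ _ fun x _ => ?_
    refine (natDegree_C_mul_X_pow_le _ _).trans ?_
    unfold auxExponent
    have h1 : m * x.2.1 ≤ m * A := Nat.mul_le_mul_left _ x.2.1.2.le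
    have h2 : l * x.2.2 ≤ l * M := Nat.mul_le_mul_left _ x.2.2.2.le
    have h3 : h * x.1 ≤ h * (J - 1) := Nat.mul_le_mul_left _ (by have := x.1.2; omega)
    omega
  have hUV : (U ^ (i : ℕ) * V ^ (I - 1 - i)).natDegree ≤ (I - 1) * D := by
    have h1 : (U ^ (i : ℕ)).natDegree ≤ i * D :=
      natDegree_pow_le.trans (Nat.mul_le_mul_left _ hU)
    have h2 : (V ^ (I - 1 - i)).natDegree ≤ (I - 1 - i) * D :=
      natDegree_pow_le.trans (Nat.mul_le_mul_left _ hV)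
    have h3 : I - 1 = i + (I - 1 - i) := by
      have := i.2
      omega
    calc _ ≤ _ := natDegree_mul_le
      _ ≤ i * D + (I - 1 - i) * D := add_le_add h1 h2
      _ = (i + (I - 1 - i)) * D := by ring
      _ = _ := by rw [← h3]
  have := natDegree_mul_le (p := Q i) (q := U ^ (i : ℕ) * V ^ (I - 1 - i))
  omega
end

section

variable {F : Type*} [Field F]

/-- Two coprime-exponent binomials share at most one (simple) root. -/
theorem isCoprime_or_exists_common_root {p : ℕ} [CharP F p] {m l : ℕ} {α β : F} {y w : F[X]}
    (hy : y = 1 - C α * X ^ m) (hw : w = 1 - C β * X ^ l) (hα : α ≠ 0) (hβ : β ≠ 0)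
    (hm : 0 < m) (hl : 0 < l) (hlp : l < p) (hcop : Nat.Coprime m l) :
    IsCoprime w y ∨ ∃ z₀ W, w = (X - C z₀) * W ∧ IsCoprime (X - C z₀) W ∧ IsCoprime W y ∧
      y.eval z₀ = 0 := by
  obtain ⟨u, v, huv⟩ : ∃ u v : ℕ, m * u = 1 + l * v := by
    rcases Nat.lt_or_ge 1 l with h | h
    · obtain ⟨u, _, hu⟩ := Nat.exists_mul_mod_eq_one_of_coprime hcop h
      refine ⟨u, m * u / l, ?_⟩
      have := Nat.div_add_mod (m * u) l
      omega
    · exact ⟨1, m - 1, by have : l = 1 := by omega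
                          subst this; omega⟩
  set γ : F := β ^ v * (α ^ u)⁻¹ with hγ
  have hdvd : ∀ e : F[X], e ∣ y → e ∣ w → e ∣ X - C γ := by
    intro e hey hew
    have h1 : e ∣ 1 - (C α * X ^ m) ^ u := by
      refine hey.trans ?_
      rw [hy]
      simpa using sub_dvd_pow_sub_pow (1 : F[X]) (C α * X ^ m) u
    have h2 : e ∣ 1 - (C β * X ^ l) ^ v := by
      refine hew.trans ?_
      rw [hw]
      simpa using sub_dvd_pow_sub_pow (1 : F[X]) (C β * X ^ l) v
    have h3 : X - C γ = C (α ^ u)⁻¹ * (C (α ^ u) * X * (1 - (C β * X ^ l) ^ v)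
        - C (β ^ v) * (1 - (C α * X ^ m) ^ u)) := by
      have h4 : (C α * X ^ m : F[X]) ^ u = C (α ^ u) * (X * X ^ (l * v)) := by
        rw [mul_pow, ← pow_mul, huv, pow_add, pow_one, C_pow]
      have h5 : (C β * X ^ l : F[X]) ^ v = C (β ^ v) * X ^ (l * v) := by
        rw [mul_pow, ← pow_mul, C_pow]
      have h6 : C (α ^ u)⁻¹ * C (α ^ u) = (1 : F[X]) := by
        rw [← C_mul, inv_mul_cancel₀ (pow_ne_zero _ hα), C_1]
      rw [h4, h5, hγ, C_mul]
      linear_combination (-X) * h6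
    rw [h3]
    exact Dvd.dvd.mul_left (dvd_sub (Dvd.dvd.mul_left h2 _) (Dvd.dvd.mul_left h1 _)) _
  have hlF : (l : F) ≠ 0 := fun h0 => by
    have := Nat.le_of_dvd hl ((CharP.cast_eq_zero_iff F p l).1 h0)
    omega
  have hsep : w.Separable := by
    have h1 : w = C (-β) * (X ^ l - C β⁻¹) := by
      rw [hw, mul_sub, ← C_mul]
      simp [hβ]
      ring
    rw [h1]
    exact (separable_X_pow_sub_C _ hlF (inv_ne_zero hβ)).unit_mul
      ((neg_ne_zero.2 hβ).isUnit.map C)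
  by_cases hc : X - C γ ∣ w ∧ X - C γ ∣ y
  · right
    obtain ⟨⟨W, hW⟩, hyγ⟩ := hc
    have hcopW : IsCoprime (X - C γ) W := (hW ▸ hsep).isCoprime
    refine ⟨γ, W, hW, hcopW, ?_, dvd_iff_isRoot.1 hyγ⟩
    apply IsRelPrime.isCoprime
    intro e heW hey
    have h1 := hdvd e hey (hW ▸ Dvd.dvd.mul_left heW _)
    exact hcopW.isRelPrime h1 heW
  · left
    apply IsRelPrime.isCoprime
    intro e hew hey
    have h1 := hdvd e hey hew
    rcases (irreducible_X_sub_C γ).dvd_iff.1 h1 with h2 | h2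
    · exact h2
    · exact absurd ⟨h2.dvd.trans hew, h2.dvd.trans hey⟩ hc

theorem mul_card_le_of_pow_eq {p : ℕ} [CharP F p] {m l h I J M a₁ a₂ b₁ c₂ D : ℕ}
    {α β κ : F} {y w : F[X]} (hy : y = 1 - C α * X ^ m) (hw : w = 1 - C β * X ^ l) (hβ : β ≠ 0)
    (hm : 0 < m) (hml : m ≤ l) (hcop : Nat.Coprime m l) (hMp : M ≤ p)
    (hb : M * J ≤ b₁)
    (hIJ : 8 * M < I * J) (hE : m * min M l + l * M ≤ h) (hJ : h * J ≤ (p - 1) * l)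
    (hU : (y ^ a₁ * w ^ b₁).natDegree ≤ D) (hV : (y ^ a₂ * X ^ c₂).natDegree ≤ D)
    (hc : IsCoprime w (y ^ a₂ * X ^ c₂) ∨ (2 ≤ min M l ∧ ∃ z₀ W, w = (X - C z₀) * W ∧
      IsCoprime (X - C z₀) W ∧ IsCoprime W (y ^ a₂ * X ^ c₂)))
    (Z : Finset F) (hZ : ∀ z ∈ Z, z ^ h = 1 ∧ y.eval z ≠ 0 ∧ w.eval z ≠ 0 ∧
      (y ^ a₁ * w ^ b₁).eval z = κ * (y ^ a₂ * X ^ c₂).eval z) :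
    M * Z.card ≤ (I - 1) * D + (m * min M l + l * M) + h * (J - 1) := by
  rcases hc with hc | ⟨hA, z₀, W, hW, hW1, hW2⟩
  · refine mul_card_le_of_linear_conditions (N := 0) hy hw hβ hm hml hcop hMp hb hIJ hE hJ hU hV
      (fun _ => 0) (by simp) ?_ Z hZ
    intro Q i _ hd
    exact (hc.pow (m := M * J) (n := i)).dvd_of_dvd_mul_right hd
  · refine mul_card_le_of_linear_conditions (N := M * J) hy hw hβ hm hml hcop hMp hb hIJ hE hJ hU hV
      (fun k => (lcoeff F k) ∘ₗ (taylor z₀)) ?_ ?_ Z hZ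
    · have := Nat.mul_le_mul_right (J * M) hA
      calc 2 * (M * J) = 2 * (J * M) := by ring
        _ ≤ _ := this
        _ = _ := by ring
    · intro Q i hQ hd
      have h1 : (X - C z₀) ^ (M * J) ∣ Q := by
        rw [X_sub_C_pow_dvd_iff, X_pow_dvd_iff]
        intro d hd
        exact hQ ⟨d, hd⟩
      have h2 : W ^ (M * J) ∣ Q := by
        refine (hW2.pow (m := M * J) (n := i)).dvd_of_dvd_mul_right (dvd_trans ?_ hd)
        exact pow_dvd_pow_of_dvd (hW ▸ Dvd.intro_left _ rfl) _
      rw [hW, mul_pow]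
      exact (hW1.pow (m := M * J) (n := M * J)).mul_dvd h1 h2

theorem card_le_of_pow_eq {m l a₁ a₂ b₁ c₂ D : ℕ}
    {α β κ : F} {y w : F[X]} (hy : y = 1 - C α * X ^ m) (hw : w = 1 - C β * X ^ l) (hβ : β ≠ 0)
    (hm : 0 < m) (hl : 0 < l) (hb : 0 < b₁)
    (hU : (y ^ a₁ * w ^ b₁).natDegree ≤ D) (hV : (y ^ a₂ * X ^ c₂).natDegree ≤ D)
    (hc : IsCoprime w (y ^ a₂ * X ^ c₂) ∨ (2 ≤ l ∧ ∃ z₀ W, w = (X - C z₀) * W ∧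
      IsCoprime (X - C z₀) W ∧ IsCoprime W (y ^ a₂ * X ^ c₂)))
    (Z : Finset F) (hZ : ∀ z ∈ Z, 
      (y ^ a₁ * w ^ b₁).eval z = κ * (y ^ a₂ * X ^ c₂).eval z) :
    Z.card ≤ D := by
  have hwdeg : w.natDegree = l := by
    have h1 : w = -(C β * X ^ l - C 1) := by rw [hw]; simp
    rw [h1, natDegree_neg, natDegree_sub_C, natDegree_C_mul_X_pow _ _ hβ]
  have hw0 : w ≠ 0 := by
    rintro h0
    rw [h0] at hwdeg
    simp at hwdeg
    omega
  have hy0 : y ≠ 0 := by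
    rintro h0
    have := congrArg (eval 0) hy
    simp [h0, hm.ne'] at this
  obtain ⟨W, hWd, hWw, hWV⟩ : ∃ W : F[X], 0 < W.natDegree ∧ W ∣ w ∧
      IsCoprime W (y ^ a₂ * X ^ c₂) := by
    rcases hc with hc | ⟨hl2, z₀, W, hW, -, hWV⟩
    · exact ⟨w, by omega, dvd_rfl, hc⟩
    · refine ⟨W, ?_, hW ▸ Dvd.intro_left _ rfl, hWV⟩
      have hW0 : W ≠ 0 := by rintro rfl; simp at hW; exact hw0 hW
      rw [hW, natDegree_mul (X_sub_C_ne_zero _) hW0, natDegree_X_sub_C] at hwdeg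
      omega
  have hne : y ^ a₁ * w ^ b₁ - C κ * (y ^ a₂ * X ^ c₂) ≠ 0 := by
    intro h0
    rw [sub_eq_zero] at h0
    have hκ : κ ≠ 0 := by
      rintro rfl
      rw [C_0, zero_mul] at h0
      exact mul_ne_zero (pow_ne_zero _ hy0) (pow_ne_zero _ hw0) h0
    have h1 : W ∣ C κ * (y ^ a₂ * X ^ c₂) := by
      rw [← h0]
      exact Dvd.dvd.mul_left (hWw.trans (dvd_pow_self _ hb.ne')) _
    have h2 := hWV.dvd_of_dvd_mul_right h1
    have h3 := natDegree_le_of_dvd h2 (C_ne_zero.2 hκ)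
    rw [natDegree_C] at h3
    omega
  have h1 := mul_card_le_natDegree hne 1 Z fun z hz => by
    rw [pow_one, dvd_iff_isRoot, IsRoot.def, eval_sub, hZ z hz]
    simp
  rw [one_mul] at h1
  refine h1.trans ((natDegree_sub_le _ _).trans (max_le hU ?_))
  exact (natDegree_C_mul_le _ _).trans hV

end

section

/-- The choice of parameters in Stepanov's method. -/
theorem exists_stepanov_parameter {p s t q : ℕ} (hst : s ≤ t) (htp : t ^ 2 ≤ p) (hq : 2 ≤ q)
    (hqp : 104976 * q ^ 6 ≤ p) (hqs : q ≤ s) :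
    ∃ J : ℕ, 0 < J ∧ 9 * (s * t * q) < p * J ∧ p * (J - 1) ≤ 9 * (s * t * q) ∧
      q * J * J ≤ s ∧ 2 * t * (q * J) + 1 ≤ p := by
  have hp : 0 < p := lt_of_lt_of_le (by positivity) hqp
  set J := 9 * (s * t * q) / p + 1 with hJ
  have hdiv := Nat.div_add_mod (9 * (s * t * q)) p
  have hmod := Nat.mod_lt (9 * (s * t * q)) hp
  have h1 : 9 * (s * t * q) < p * J := by rw [hJ, mul_add, mul_one]; omega
  have h2 : p * (J - 1) ≤ 9 * (s * t * q) := by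
    rw [hJ, Nat.add_sub_cancel]; omega
  have hJ0 : 1 ≤ J := Nat.le_add_left _ _
  clear_value J
  have hs2 : s ^ 2 ≤ p := (Nat.pow_le_pow_left hst 2).trans htp
  have h3 : 324 * s * q ^ 3 ≤ p := by
    have : (324 * s * q ^ 3) ^ 2 ≤ p ^ 2 := by
      calc (324 * s * q ^ 3) ^ 2 = s ^ 2 * (104976 * q ^ 6) := by ring
        _ ≤ p * p := Nat.mul_le_mul hs2 hqp
        _ = p ^ 2 := by ring
    exact (Nat.pow_le_pow_iff_left two_ne_zero).1 this
  have h3' : 324 * t * q ^ 3 ≤ p := by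
    have : (324 * t * q ^ 3) ^ 2 ≤ p ^ 2 := by
      calc (324 * t * q ^ 3) ^ 2 = t ^ 2 * (104976 * q ^ 6) := by ring
        _ ≤ p * p := Nat.mul_le_mul htp hqp
        _ = p ^ 2 := by ring
    exact (Nat.pow_le_pow_iff_left two_ne_zero).1 this
  have hJ2 : J = 1 ∨ p * J ≤ 18 * (s * t * q) := by
    rcases Nat.lt_or_ge J 2 with h | h
    · left; omega
    · right
      calc p * J ≤ p * (2 * (J - 1)) := Nat.mul_le_mul_left _ (by omega)
        _ = 2 * (p * (J - 1)) := by ring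
        _ ≤ _ := by omega
  have h4 : q * J * J ≤ s := by
    rcases hJ2 with h | h
    · rw [h]; omega
    · have h5 : p * p * (q * J * J) ≤ p * p * s := by
        calc p * p * (q * J * J) = q * (p * J) ^ 2 := by ring
          _ ≤ q * (18 * (s * t * q)) ^ 2 := Nat.mul_le_mul_left _ (Nat.pow_le_pow_left h 2)
          _ = t ^ 2 * (324 * s * q ^ 3) * s := by ring
          _ ≤ p * p * s := Nat.mul_le_mul_right _ (Nat.mul_le_mul htp h3)
      exact Nat.le_of_mul_le_mul_left h5 (Nat.mul_pos hp hp)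
  have h6 : J ≤ 18 * q := by
    rcases hJ2 with h | h
    · omega
    · have h5 : p * J ≤ p * (18 * q) := by
        have : s * t ≤ p := by nlinarith
        calc p * J ≤ 18 * (s * t * q) := h
          _ = (s * t) * (18 * q) := by ring
          _ ≤ _ := Nat.mul_le_mul_right _ this
      exact Nat.le_of_mul_le_mul_left h5 hp
  refine ⟨J, by omega, h1, h2, h4, ?_⟩
  have ht : 1 ≤ t := by omega
  calc 2 * t * (q * J) + 1 ≤ 2 * t * (q * (18 * q)) + 1 := by gcongr
    _ ≤ 324 * t * q ^ 3 := by
      have : 1 ≤ t * q ^ 2 := Nat.mul_pos ht (by positivity)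
      have h7 : t * q ^ 2 * 2 ≤ t * q ^ 2 * q := Nat.mul_le_mul_left _ hq
      nlinarith
    _ ≤ p := h3'

variable {F : Type*} [Field F]

theorem mul_card_le_of_pow_eq_of_mul_eq {p : ℕ} [CharP F p] {m l g h q a₁ a₂ c₂ : ℕ} {α β κ : F}
    {y w : F[X]} (hy : y = 1 - C α * X ^ m) (hw : w = 1 - C β * X ^ l) (hβ : β ≠ 0)
    (hgh : g * h = p - 1) (hg : 0 < g) (hm : 0 < m) (hml : m ≤ l) (hcop : Nat.Coprime m l)
    (hlp : (g * l) ^ 2 ≤ p) (hq : 2 ≤ q) (hqp : 104976 * q ^ 6 ≤ p)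
    (hU : (y ^ a₁ * w ^ (g * m)).natDegree ≤ 2 * (g * m * l))
    (hV : (y ^ a₂ * X ^ c₂).natDegree ≤ 2 * (g * m * l))
    (hc : IsCoprime w (y ^ a₂ * X ^ c₂) ∨ (2 ≤ l ∧ ∃ z₀ W, w = (X - C z₀) * W ∧
      IsCoprime (X - C z₀) W ∧ IsCoprime W (y ^ a₂ * X ^ c₂)))
    (Z : Finset F) (hZ : ∀ z ∈ Z, z ^ h = 1 ∧ y.eval z ≠ 0 ∧ w.eval z ≠ 0 ∧
      (y ^ a₁ * w ^ (g * m)).eval z = κ * (y ^ a₂ * X ^ c₂).eval z) :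
    q * (g * Z.card) ≤ 4 * p := by
  have hp : 0 < p := lt_of_lt_of_le (by positivity) hqp
  have hst : g * m ≤ g * l := Nat.mul_le_mul_left _ hml
  rcases Nat.lt_or_ge (g * m) q with hs | hs
  · have h1 := card_le_of_pow_eq hy hw hβ hm (by omega) (Nat.mul_pos hg hm) hU hV hc Z
      fun z hz => (hZ z hz).2.2.2
    have h3 : 324 * (g * l) * q ^ 3 ≤ p := by
      have : (324 * (g * l) * q ^ 3) ^ 2 ≤ p ^ 2 := by
        calc (324 * (g * l) * q ^ 3) ^ 2 = (g * l) ^ 2 * (104976 * q ^ 6) := by ring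
          _ ≤ p * p := Nat.mul_le_mul hlp hqp
          _ = p ^ 2 := by ring
      exact (Nat.pow_le_pow_iff_left two_ne_zero).1 this
    calc q * (g * Z.card) ≤ q * (g * (2 * (g * m * l))) := by gcongr
      _ = 2 * (g * m) * (g * l) * q := by ring
      _ ≤ 2 * q * (g * l) * q := by gcongr
      _ = 2 * (g * l) * q ^ 2 * 1 := by ring
      _ ≤ 2 * (g * l) * q ^ 2 * (162 * q) := by gcongr; omega
      _ = 324 * (g * l) * q ^ 3 := by ring
      _ ≤ 4 * p := by omega
  · obtain ⟨J, hJ0, hJ1, hJ2, hJ3, hJ4⟩ := exists_stepanov_parameter hst hlp hq hqp hs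
    have hJs : q * J ≤ g * m := le_trans (Nat.le_mul_of_pos_right _ hJ0) hJ3
    have hJt : J ≤ g * l := le_trans (Nat.le_mul_of_pos_left _ (by omega)) (hJs.trans hst)
    have htp : g * l ≤ p := le_trans (Nat.le_self_pow two_ne_zero _) hlp
    have hE' : g * (m * min (q * J) l + l * (q * J)) ≤ 2 * (g * l) * (q * J) := by
      calc g * (m * min (q * J) l + l * (q * J)) ≤ g * (l * (q * J) + l * (q * J)) := by
            gcongr; exact min_le_left _ _
        _ = _ := by ring
    have hmain := mul_card_le_of_pow_eq (M := q * J) (J := J) (I := 9 * q) (κ := κ)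
      (D := 2 * (g * m * l)) (h := h) (b₁ := g * m) (a₁ := a₁) (a₂ := a₂) (c₂ := c₂)
      hy hw hβ hm hml hcop (hJs.trans (hst.trans htp)) hJ3
      (by have : 0 < q * J := Nat.mul_pos (by omega) hJ0
          nlinarith)
      (by refine Nat.le_of_mul_le_mul_left ?_ hg
          rw [hgh]; omega)
      (by rw [← hgh]
          calc h * J ≤ h * (g * l) := Nat.mul_le_mul_left _ hJt
            _ = _ := by ring)
      hU hV
      (hc.imp id fun h => ⟨le_min (hq.trans (Nat.le_mul_of_pos_right _ hJ0)) h.1, h.2⟩) Z hZ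
    have h5 : J * (q * (g * Z.card)) ≤ J * (4 * p) := by
      calc J * (q * (g * Z.card)) = g * (q * J * Z.card) := by ring
        _ ≤ g * ((9 * q - 1) * (2 * (g * m * l)) + (m * min (q * J) l + l * (q * J))
            + h * (J - 1)) := Nat.mul_le_mul_left _ hmain
        _ = g * ((9 * q - 1) * (2 * (g * m * l))) + g * (m * min (q * J) l + l * (q * J))
            + g * h * (J - 1) := by ring
        _ ≤ 2 * (9 * (g * m * (g * l) * q)) + p + p * (J - 1) := by
            rw [hgh]
            refine add_le_add (add_le_add ?_ (hE'.trans (by omega)))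
              (Nat.mul_le_mul_right _ (Nat.sub_le _ _))
            calc g * ((9 * q - 1) * (2 * (g * m * l))) ≤ g * ((9 * q) * (2 * (g * m * l))) := by
                  gcongr; omega
              _ = _ := by ring
        _ ≤ 2 * (p * J) + p * J + p * J := by
            have h6 : p ≤ p * J := Nat.le_mul_of_pos_right _ hJ0
            have h7 : p * (J - 1) ≤ p * J := Nat.mul_le_mul_left _ (Nat.sub_le _ _)
            omega
        _ = _ := by ring
    exact Nat.le_of_mul_le_mul_left h5 hJ0

end

section

variable {F : Type*} [Field F]

theorem mul_card_le_of_pow_eq_pow {p : ℕ} [CharP F p] {m l g h q : ℕ} {α β κ : F}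
    {y w : F[X]} (hy : y = 1 - C α * X ^ m) (hw : w = 1 - C β * X ^ l) (hα : α ≠ 0) (hβ : β ≠ 0)
    (hgh : g * h = p - 1) (hg : 0 < g) (hm : 0 < m) (hml : m ≤ l) (hcop : Nat.Coprime m l)
    (hlp : (g * l) ^ 2 ≤ p) (hq : 2 ≤ q) (hqp : 104976 * q ^ 6 ≤ p)
    (hc : IsCoprime w y ∨ 2 ≤ l)
    (Z : Finset F) (hZ : ∀ z ∈ Z, z ^ h = 1 ∧ y.eval z ≠ 0 ∧ w.eval z ≠ 0 ∧
      w.eval z ^ (g * m) = κ * y.eval z ^ (g * l)) :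
    q * (g * Z.card) ≤ 4 * p := by
  have hdy : y.natDegree ≤ m := by
    rw [hy]; compute_degree
  have hdw : w.natDegree ≤ l := by
    rw [hw]; compute_degree
  have h1 : 1 < p := by
    have : 0 < q ^ 6 := by positivity
    omega
  have hl : l < p := by
    have h2 : l ≤ g * l := Nat.le_mul_of_pos_left _ hg
    nlinarith
  refine mul_card_le_of_pow_eq_of_mul_eq (a₁ := 0) (a₂ := g * l) (c₂ := 0) (κ := κ) hy hw hβ hgh hg
    hm hml hcop hlp hq hqp ?_ ?_ ?_ Z ?_
  · rw [pow_zero, one_mul]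
    refine natDegree_pow_le.trans ?_
    calc g * m * w.natDegree ≤ g * m * l := Nat.mul_le_mul_left _ hdw
      _ ≤ _ := by omega
  · rw [pow_zero, mul_one]
    refine natDegree_pow_le.trans ?_
    calc g * l * y.natDegree ≤ g * l * m := Nat.mul_le_mul_left _ hdy
      _ = g * m * l := by ring
      _ ≤ _ := by omega
  · rw [pow_zero, mul_one]
    rcases isCoprime_or_exists_common_root (p := p) hy hw hα hβ hm (by omega) hl hcop with
      h | ⟨z₀, W, hW, hW1, hW2, h3⟩
    · exact Or.inl h.pow_right
    · rcases hc with hc | hc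
      · exact Or.inl hc.pow_right
      · exact Or.inr ⟨hc, z₀, W, hW, hW1, hW2.pow_right⟩
  · intro z hz
    simpa using hZ z hz

theorem mul_card_le_of_pow_mul_pow_eq {p : ℕ} [CharP F p] {m l g h q : ℕ} {α β κ : F}
    {y w : F[X]} (hy : y = 1 - C α * X ^ m) (hw : w = 1 - C β * X ^ l) (hβ : β ≠ 0)
    (hgh : g * h = p - 1) (hg : 0 < g) (hm : 0 < m) (hml : m ≤ l) (hcop : Nat.Coprime m l)
    (hlp : (g * l) ^ 2 ≤ p) (hq : 2 ≤ q) (hqp : 104976 * q ^ 6 ≤ p)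
    (Z : Finset F) (hZ : ∀ z ∈ Z, z ^ h = 1 ∧ y.eval z ≠ 0 ∧ w.eval z ≠ 0 ∧
      y.eval z ^ (g * l) * w.eval z ^ (g * m) = κ * z ^ (g * m * l)) :
    q * (g * Z.card) ≤ 4 * p := by
  have hdy : y.natDegree ≤ m := by
    rw [hy]; compute_degree
  have hdw : w.natDegree ≤ l := by
    rw [hw]; compute_degree
  refine mul_card_le_of_pow_eq_of_mul_eq (a₁ := g * l) (a₂ := 0) (c₂ := g * m * l) (κ := κ)
    hy hw hβ hgh hg hm hml hcop hlp hq hqp ?_ ?_ ?_ Z ?_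
  · refine natDegree_mul_le.trans ((add_le_add natDegree_pow_le natDegree_pow_le).trans ?_)
    calc g * l * y.natDegree + g * m * w.natDegree ≤ g * l * m + g * m * l := by gcongr
      _ = _ := by ring
  · rw [pow_zero, one_mul, natDegree_X_pow]
    omega
  · left
    rw [pow_zero, one_mul]
    refine IsCoprime.pow_right ⟨1, C β * X ^ (l - 1), ?_⟩
    rw [mul_assoc, ← pow_succ, Nat.sub_add_cancel (by omega), hw]
    ring
  · intro z hz
    simpa using hZ z hz

/-- A Dirichlet-type approximation: `k` is congruent to a ratio `± t / s` of small integers. -/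
theorem exists_small_ratio {p k : ℕ} (hp : 8 ≤ p) (hk : Nat.Coprime k (p - 1)) :
    ∃ g h s t : ℕ, g * h = p - 1 ∧ 0 < g ∧ 0 < s ∧ 0 < t ∧ Nat.Coprime s t ∧ Nat.Coprime s h ∧
      (g * s) ^ 2 ≤ p ∧ (g * t) ^ 2 ≤ p ∧
      ((h : ℤ) ∣ s * k - t ∨ (h : ℤ) ∣ s * k + t) := by
  set n := Nat.sqrt p with hn
  have hn1 : n ^ 2 ≤ p := Nat.sqrt_le' p
  have hn2 : p < (n + 1) ^ 2 := Nat.lt_succ_sqrt' p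
  have hn0 : 0 < n := by
    rcases Nat.eq_zero_or_pos n with h | h
    · rw [h] at hn2; omega
    · exact h
  obtain ⟨j, s', hs0, hsn, hjs⟩ := Real.exists_int_int_abs_mul_sub_le ((k : ℝ) / (p - 1 : ℕ)) hn0
  obtain ⟨s', rfl⟩ := Int.eq_ofNat_of_zero_le hs0.le
  have hp1 : (0 : ℝ) < (p - 1 : ℕ) := by exact_mod_cast (by omega : 0 < p - 1)
  set T : ℤ := s' * k - j * (p - 1 : ℕ) with hT
  have hTabs : |(T : ℝ)| * (n + 1) ≤ (p - 1 : ℕ) := by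
    have h1 : (T : ℝ) = ((k : ℝ) / (p - 1 : ℕ) * ((s' : ℤ) : ℝ) - j) * (p - 1 : ℕ) := by
      rw [hT]; push_cast; field_simp
    rw [h1, abs_mul, abs_of_pos hp1, mul_comm (_ / _)]
    rw [le_div_iff₀ (by positivity)] at hjs
    nlinarith
  have hT2 : T.natAbs * (n + 1) ≤ p - 1 := by
    have : ((T.natAbs * (n + 1) : ℕ) : ℝ) ≤ (p - 1 : ℕ) := by
      push_cast
      rw [Nat.cast_natAbs]
      push_cast
      exact hTabs
    exact_mod_cast this
  have hTn : T.natAbs ≤ n := by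
    by_contra h
    have : (n + 1) * (n + 1) ≤ T.natAbs * (n + 1) := Nat.mul_le_mul_right _ (by omega)
    have h3 : (n + 1) ^ 2 = (n + 1) * (n + 1) := by ring
    omega
  have hs0' : 0 < s' := by exact_mod_cast hs0
  have hsn' : s' ≤ n := by exact_mod_cast hsn
  have hT0 : 0 < T.natAbs := by
    rw [Int.natAbs_pos]
    intro h0
    have h1 : ((p - 1 : ℕ) : ℤ) ∣ ((s' * k : ℕ) : ℤ) := ⟨j, by push_cast; linarith⟩
    have h2 : p - 1 ∣ s' := hk.symm.dvd_of_dvd_mul_right (Int.natCast_dvd_natCast.1 h1)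
    have h3 := Nat.le_of_dvd hs0' h2
    have : n + 1 < p := by nlinarith
    omega
  set g₀ := Nat.gcd s' T.natAbs with hg₀
  have hg₀0 : 0 < g₀ := Nat.gcd_pos_of_pos_left _ hs0'
  obtain ⟨s, hs⟩ : g₀ ∣ s' := Nat.gcd_dvd_left _ _
  obtain ⟨t, ht⟩ : g₀ ∣ T.natAbs := Nat.gcd_dvd_right _ _
  have hcop : Nat.Coprime s t := by
    have h1 := Nat.coprime_div_gcd_div_gcd (m := s') (n := T.natAbs) hg₀0
    rw [← hg₀, hs, ht, Nat.mul_div_cancel_left _ hg₀0, Nat.mul_div_cancel_left _ hg₀0] at h1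
    exact h1
  set g := Nat.gcd g₀ (p - 1) with hg
  have hg0 : 0 < g := Nat.gcd_pos_of_pos_left _ hg₀0
  obtain ⟨e, he⟩ : g ∣ g₀ := Nat.gcd_dvd_left _ _
  obtain ⟨h, hh⟩ : g ∣ p - 1 := Nat.gcd_dvd_right _ _
  have hcop' : Nat.Coprime e h := by
    have h1 := Nat.coprime_div_gcd_div_gcd (m := g₀) (n := p - 1) hg0
    rw [← hg, he, hh, Nat.mul_div_cancel_left _ hg0, Nat.mul_div_cancel_left _ hg0] at h1
    exact h1
  have hgg : g ≤ g₀ := Nat.le_of_dvd hg₀0 ⟨e, he⟩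
  have hsp : 0 < s := Nat.pos_of_ne_zero fun h0 => by rw [h0] at hs; omega
  have htp : 0 < t := Nat.pos_of_ne_zero fun h0 => by rw [h0] at ht; omega
  have hdvd : (h : ℤ) ∣ s * k - t ∨ (h : ℤ) ∣ s * k + t := by
    have key : ∀ r : ℤ, T = g₀ * r → (h : ℤ) ∣ s * k - r := by
      intro r hr
      have h1 : (e : ℤ) * (s * k - r) = h * j := by
        have h2 : (g : ℤ) * ((e : ℤ) * (s * k - r)) = g * (h * j) := by
          have h3 : (s' : ℤ) = g₀ * s := by exact_mod_cast hs
          have h4 : (g₀ : ℤ) = g * e := by exact_mod_cast he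
          have h5 : ((p - 1 : ℕ) : ℤ) = g * h := by exact_mod_cast hh
          rw [h3, h5] at hT
          rw [h4] at hT hr
          linear_combination -hT + hr
        exact mul_left_cancel₀ (by exact_mod_cast hg0.ne') h2
      exact (Int.isCoprime_iff_gcd_eq_one.2 (by simpa using hcop'.symm)).dvd_of_dvd_mul_left
        ⟨j, h1⟩
    have h6 : (T.natAbs : ℤ) = g₀ * t := by exact_mod_cast ht
    rcases Int.natAbs_eq T with h | h
    · left
      exact key t (by rw [h, h6])
    · right
      have := key (-t) (by rw [h, h6]; ring)
      rwa [sub_neg_eq_add] at this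
  refine ⟨g, h, s, t, hh.symm, hg0, hsp, htp, hcop, ?_, ?_, ?_, hdvd⟩
  · have hc : IsCoprime (s : ℤ) (t : ℤ) := Nat.isCoprime_iff_coprime.2 hcop
    rw [← Nat.isCoprime_iff_coprime]
    obtain ⟨a, b, hab⟩ := hc
    rcases hdvd with ⟨c, hc⟩ | ⟨c, hc⟩
    · exact ⟨a + b * k, -b * c, by linear_combination hab + b * hc⟩
    · exact ⟨a - b * k, b * c, by linear_combination hab - b * hc⟩
  · refine le_trans (Nat.pow_le_pow_left ?_ 2) hn1
    calc g * s ≤ g₀ * s := Nat.mul_le_mul_right _ hgg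
      _ ≤ n := by omega
  · refine le_trans (Nat.pow_le_pow_left ?_ 2) hn1
    calc g * t ≤ g₀ * t := Nat.mul_le_mul_right _ hgg
      _ ≤ n := by omega

end

section

theorem pow_mul_eq_pow_of_dvd {F : Type*} [Field F] {h s k t : ℕ} {z : F} (hz0 : z ≠ 0)
    (hz : z ^ h = 1) (hd : (h : ℤ) ∣ s * k - t) : (z ^ k) ^ s = z ^ t := by
  obtain ⟨c, hc⟩ := hd
  have h1 : z ^ ((s : ℤ) * k - t) = 1 := by
    rw [hc, zpow_mul, zpow_natCast, hz, one_zpow]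
  rw [zpow_sub₀ hz0, div_eq_one_iff_eq (zpow_ne_zero _ hz0)] at h1
  rw [← pow_mul, mul_comm]
  exact_mod_cast h1

theorem pow_mul_mul_pow_eq_one_of_dvd {F : Type*} [Field F] {h s k t : ℕ} {z : F} (hz0 : z ≠ 0)
    (hz : z ^ h = 1) (hd : (h : ℤ) ∣ s * k + t) : (z ^ k) ^ s * z ^ t = 1 := by
  obtain ⟨c, hc⟩ := hd
  have h1 : z ^ ((s : ℤ) * k + t) = 1 := by
    rw [hc, zpow_mul, zpow_natCast, hz, one_zpow]
  rw [zpow_add₀ hz0] at h1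
  rw [← pow_mul, mul_comm k]
  exact_mod_cast h1

theorem mul_card_fiber_le {p : ℕ} [Fact p.Prime] {g h s t q k : ℕ} {v x₀ : ZMod p} (hk : 1 ≤ k)
    (hgh : g * h = p - 1) (hg : 0 < g) (hs : 0 < s) (ht : 0 < t) (hst : Nat.Coprime s t)
    (hsh : Nat.Coprime s h) (hgs : (g * s) ^ 2 ≤ p) (hgt : (g * t) ^ 2 ≤ p) (hq : 2 ≤ q)
    (hqp : 104976 * q ^ 6 ≤ p) (hdvd : (h : ℤ) ∣ s * k - t ∨ (h : ℤ) ∣ s * k + t)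
    (hv : v ≠ 0) (hx₀ : x₀ ≠ 0) (T : Finset (ZMod p))
    (hT : ∀ x ∈ T, x ^ h = x₀ ^ h ∧ x ≠ 0 ∧ x ≠ 1 ∧ x ^ k + (1 - x) ^ k = v ∧ x ^ (k - 1) ≠ v) :
    q * (g * T.card) ≤ 4 * p := by
  classical
  obtain ⟨a, b, hab⟩ := Nat.isCoprime_iff_coprime.2 hsh
  set φ : ZMod p → ZMod p := fun x => (x / x₀) ^ a with hφ
  have hφ1 : ∀ x ∈ T, φ x ^ h = 1 ∧ φ x ≠ 0 ∧ x = x₀ * φ x ^ s := by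
    intro x hx
    obtain ⟨h1, h2, -⟩ := hT x hx
    have h0 : x / x₀ ≠ 0 := div_ne_zero h2 hx₀
    have h3 : (x / x₀) ^ h = 1 := by
      rw [div_pow, h1, div_self (pow_ne_zero _ hx₀)]
    refine ⟨?_, zpow_ne_zero _ h0, ?_⟩
    · rw [hφ]
      change ((x / x₀) ^ a) ^ h = 1
      rw [← zpow_natCast, ← zpow_mul, mul_comm, zpow_mul, zpow_natCast, h3, one_zpow]
    · change x = x₀ * ((x / x₀) ^ a) ^ s
      have h4 : ((x / x₀) ^ a) ^ s = x / x₀ := by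
        rw [← zpow_natCast, ← zpow_mul, eq_sub_of_add_eq hab, zpow_sub₀ h0, mul_comm b, zpow_mul,
          zpow_natCast, h3, one_zpow, zpow_one, div_one]
      rw [h4, mul_div_cancel₀ _ hx₀]
  have hcard : (T.image φ).card = T.card := by
    refine Finset.card_image_of_injOn fun x hx y hy hxy => ?_
    rw [(hφ1 x hx).2.2, (hφ1 y hy).2.2, hxy]
  have hug : ∀ u : ZMod p, u ≠ 0 → (u ^ g) ^ h = 1 := fun u hu => by
    rw [← pow_mul, hgh, ZMod.pow_card_sub_one_eq_one hu]
  rw [← hcard]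
  have hx₀k : x₀ ^ k ≠ 0 := pow_ne_zero _ hx₀
  set Y : (ZMod p)[X] := 1 - C x₀ * X ^ s with hY
  rcases hdvd with hdvd | hdvd
  · set β := v⁻¹ * x₀ ^ k with hβ
    have hβ0 : β ≠ 0 := mul_ne_zero (inv_ne_zero hv) hx₀k
    set W : (ZMod p)[X] := 1 - C β * X ^ t with hW
    have key : ∀ z ∈ T.image φ, z ^ h = 1 ∧ Y.eval z ≠ 0 ∧ W.eval z ≠ 0 ∧
        v ^ (g * s) * W.eval z ^ (g * s) = Y.eval z ^ (g * t) := by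
      intro z hz
      obtain ⟨x, hx, rfl⟩ := Finset.mem_image.1 hz
      obtain ⟨-, h2, h3, h4, -⟩ := hT x hx
      obtain ⟨h5, h6, h7⟩ := hφ1 x hx
      have hYe : Y.eval (φ x) = 1 - x := by
        rw [hY]; simp only [eval_sub, eval_one, eval_mul, eval_C, eval_pow, eval_X]
        rw [← h7]
      have h8 : x ^ k = x₀ ^ k * φ x ^ t := by
        rw [← pow_mul_eq_pow_of_dvd h6 h5 hdvd]
        conv_lhs => rw [h7]
        ring
      have hWe : v * W.eval (φ x) = (1 - x) ^ k := by
        rw [hW]; simp only [eval_sub, eval_one, eval_mul, eval_C, eval_pow, eval_X]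
        rw [hβ, mul_sub, mul_one, ← mul_assoc, mul_inv_cancel_left₀ hv, ← h8, ← h4]
        ring
      have h1x : 1 - x ≠ 0 := sub_ne_zero.2 h3.symm
      refine ⟨h5, by rwa [hYe], fun h0 => ?_, ?_⟩
      · rw [h0, mul_zero] at hWe
        exact pow_ne_zero _ h1x hWe.symm
      · rw [← mul_pow, hWe, hYe, pow_mul (1 - x) g t, ← pow_mul_eq_pow_of_dvd (pow_ne_zero _ h1x)
          (hug _ h1x) hdvd]
        ring
    have hc : ∀ m l : ℕ, ∀ y w : (ZMod p)[X], (Y = y ∧ W = w ∧ m = s ∧ l = t ∨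
        Y = w ∧ W = y ∧ m = t ∧ l = s) → m ≤ l → (T.image φ).Nonempty →
        IsCoprime w y ∨ 2 ≤ l := by
      intro m l y w hyw hml hne
      rcases Nat.lt_or_ge l 2 with hl | hl
      swap
      · exact Or.inr hl
      left
      have hs1 : s = 1 := by rcases hyw with h | h <;> omega
      have ht1 : t = 1 := by rcases hyw with h | h <;> omega
      have hcop : IsCoprime Y W := by
        obtain ⟨_, hz⟩ := hne
        obtain ⟨x, hx, -⟩ := Finset.mem_image.1 hz
        obtain ⟨-, h2, -, -, h4⟩ := hT x hx
        obtain ⟨h5, h6, h7⟩ := hφ1 x hx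
        have hne : β - x₀ ≠ 0 := by
          intro h0
          have h8 := pow_mul_eq_pow_of_dvd h6 h5 hdvd
          have h9 : x ^ k = x₀ ^ k * φ x ^ t := by
            rw [← h8]
            conv_lhs => rw [h7]
            ring
          have h10 : x ^ k = v * x := by
            rw [h9]
            conv_rhs => rw [h7]
            rw [hs1, ht1, ← mul_assoc]
            congr 1
            rw [← sub_eq_zero.1 h0, hβ, mul_inv_cancel_left₀ hv, ← hβ, sub_eq_zero.1 h0]
          apply h4
          have h11 : x ^ k = x ^ (k - 1) * x := by rw [← pow_succ, Nat.sub_add_cancel hk]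
          rw [h11] at h10
          exact mul_right_cancel₀ h2 h10
        refine ⟨C (β * (β - x₀)⁻¹), C (-x₀ * (β - x₀)⁻¹), ?_⟩
        have h12 : C (β * (β - x₀)⁻¹) - C (x₀ * (β - x₀)⁻¹) = (1 : (ZMod p)[X]) := by
          rw [← C_sub, ← sub_mul, mul_inv_cancel₀ hne, C_1]
        rw [hY, hW, hs1, ht1]
        simp only [C_mul, C_neg] at h12 ⊢
        linear_combination h12
      rcases hyw with ⟨rfl, rfl, -⟩ | ⟨rfl, rfl, -⟩
      · exact hcop.symm
      · exact hcop
    rcases (T.image φ).eq_empty_or_nonempty with hemp | hne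
    · rw [hemp]; simp
    have hvp : ∀ n, v ^ n ≠ 0 := fun n => pow_ne_zero _ hv
    rcases le_total s t with hle | hle
    · refine mul_card_le_of_pow_eq_pow (κ := (v ^ (g * s))⁻¹) hY hW hx₀ hβ0 hgh hg hs hle hst hgt
        hq hqp (hc s t Y W (by simp) hle hne) _ fun z hz => ?_
      obtain ⟨h1, h2, h3, h4⟩ := key z hz
      exact ⟨h1, h2, h3, by rw [← h4, inv_mul_cancel_left₀ (hvp _)]⟩
    · refine mul_card_le_of_pow_eq_pow (κ := v ^ (g * s)) hW hY hβ0 hx₀ hgh hg ht hle hst.symm hgs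
        hq hqp (hc t s W Y (by simp) hle hne) _ fun z hz => ?_
      obtain ⟨h1, h2, h3, h4⟩ := key z hz
      exact ⟨h1, h3, h2, h4.symm⟩
  · set β := v * (x₀ ^ k)⁻¹ with hβ
    have hβ0 : β ≠ 0 := mul_ne_zero hv (inv_ne_zero hx₀k)
    set W : (ZMod p)[X] := 1 - C β * X ^ t with hW
    have key : ∀ z ∈ T.image φ, z ^ h = 1 ∧ Y.eval z ≠ 0 ∧ W.eval z ≠ 0 ∧
        (-x₀ ^ k) ^ (g * s) * (W.eval z ^ (g * s) * Y.eval z ^ (g * t)) = z ^ (g * s * t) := by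
      intro z hz
      obtain ⟨x, hx, rfl⟩ := Finset.mem_image.1 hz
      obtain ⟨-, h2, h3, h4, -⟩ := hT x hx
      obtain ⟨h5, h6, h7⟩ := hφ1 x hx
      have hYe : Y.eval (φ x) = 1 - x := by
        rw [hY]; simp only [eval_sub, eval_one, eval_mul, eval_C, eval_pow, eval_X]
        rw [← h7]
      have h8 : x ^ k * φ x ^ t = x₀ ^ k := by
        have := pow_mul_mul_pow_eq_one_of_dvd h6 h5 hdvd
        have h9 : x ^ k = x₀ ^ k * (φ x ^ k) ^ s := by
          conv_lhs => rw [h7]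
          ring
        rw [h9, mul_assoc, this, mul_one]
      have hWe : -x₀ ^ k * W.eval (φ x) = φ x ^ t * (1 - x) ^ k := by
        rw [hW]; simp only [eval_sub, eval_one, eval_mul, eval_C, eval_pow, eval_X]
        have h9 : x₀ ^ k * β = v := by rw [hβ]; field_simp
        linear_combination φ x ^ t * h9 - φ x ^ t * h4 + h8
      have h1x : 1 - x ≠ 0 := sub_ne_zero.2 h3.symm
      refine ⟨h5, by rwa [hYe], fun h0 => ?_, ?_⟩
      · rw [h0, mul_zero] at hWe
        exact mul_ne_zero (pow_ne_zero _ h6) (pow_ne_zero _ h1x) hWe.symm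
      · have h10 := pow_mul_mul_pow_eq_one_of_dvd (pow_ne_zero g h1x) (hug _ h1x) hdvd
        rw [← mul_assoc, ← mul_pow, hWe, hYe]
        linear_combination φ x ^ (g * s * t) * h10
    have hvp : ∀ n, (-x₀ ^ k) ^ n ≠ 0 := fun n => pow_ne_zero _ (neg_ne_zero.2 hx₀k)
    rcases le_total s t with hle | hle
    · refine mul_card_le_of_pow_mul_pow_eq (κ := ((-x₀ ^ k) ^ (g * s))⁻¹) hY hW hβ0 hgh hg hs hle
        hst hgt hq hqp _ fun z hz => ?_
      obtain ⟨h1, h2, h3, h4⟩ := key z hz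
      exact ⟨h1, h2, h3, by rw [← h4, inv_mul_cancel_left₀ (hvp _), mul_comm]⟩
    · refine mul_card_le_of_pow_mul_pow_eq (κ := ((-x₀ ^ k) ^ (g * s))⁻¹) hW hY hx₀ hgh hg ht hle
        hst.symm hgs hq hqp _ fun z hz => ?_
      obtain ⟨h1, h2, h3, h4⟩ := key z hz
      refine ⟨h1, h3, h2, ?_⟩
      rw [show g * t * s = g * s * t by ring, ← h4, inv_mul_cancel_left₀ (hvp _)]

theorem card_pow_eq_le_gcd {p : ℕ} [Fact p.Prime] (e : ℕ) (v : ZMod p) (he : 0 < Nat.gcd e (p - 1))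
    (T : Finset (ZMod p)) (hT : ∀ x ∈ T, x ≠ 0 ∧ x ^ e = v) : T.card ≤ Nat.gcd e (p - 1) := by
  classical
  rcases T.eq_empty_or_nonempty with rfl | ⟨x₀, hx₀⟩
  · simp
  obtain ⟨h0, hv⟩ := hT x₀ hx₀
  calc T.card ≤ (nthRoots (Nat.gcd e (p - 1)) (x₀ ^ Nat.gcd e (p - 1))).toFinset.card := by
        refine Finset.card_le_card fun x hx => ?_
        obtain ⟨h1, h2⟩ := hT x hx
        rw [Multiset.mem_toFinset, mem_nthRoots he]
        have h3 : (x / x₀) ^ e = 1 := by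
          rw [div_pow, h2, hv, div_self]
          rw [← hv]; exact pow_ne_zero _ h0
        have h4 : (x / x₀) ^ (p - 1) = 1 := ZMod.pow_card_sub_one_eq_one (div_ne_zero h1 h0)
        have h5 := orderOf_dvd_iff_pow_eq_one.1
          (Nat.dvd_gcd (orderOf_dvd_of_pow_eq_one h3) (orderOf_dvd_of_pow_eq_one h4))
        rwa [div_pow, div_eq_one_iff_eq (pow_ne_zero _ h0)] at h5
    _ ≤ _ := (Multiset.toFinset_card_le _).trans (card_nthRoots _ _)

/-- The number of solutions of `x ^ k + (1 - x) ^ k = v`. -/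
theorem mul_card_pow_add_pow_eq_le {p : ℕ} [Fact p.Prime] {q k : ℕ} {v : ZMod p} (hk : 1 ≤ k)
    (hkp : Nat.Coprime k (p - 1)) (hq : 2 ≤ q) (hqp : 104976 * q ^ 6 ≤ p) (hv : v ≠ 0)
    (T : Finset (ZMod p)) (hT : ∀ x ∈ T, x ≠ 0 ∧ x ≠ 1 ∧ x ^ k + (1 - x) ^ k = v) :
    q * T.card ≤ 4 * p + q * Nat.gcd (k - 1) (p - 1) := by
  classical
  have hp8 : 8 ≤ p := by
    have : 0 < q ^ 6 := by positivity
    omega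
  obtain ⟨g, h, s, t, hgh, hg, hs, ht, hst, hsh, hgs, hgt, hdvd⟩ := exists_small_ratio hp8 hkp
  have hd : 0 < Nat.gcd (k - 1) (p - 1) := Nat.gcd_pos_of_pos_right _ (by omega)
  rw [← Finset.card_filter_add_card_filter_not (s := T) (fun x => x ^ (k - 1) ≠ v), mul_add]
  refine add_le_add ?_ (Nat.mul_le_mul_left _ (card_pow_eq_le_gcd _ v hd _ fun x hx => ?_))
  · set T' := T.filter fun x => x ^ (k - 1) ≠ v with hT'
    have h1 : g * (q * T'.card) ≤ (4 * p) * (T'.image (· ^ h)).card := by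
      have := Finset.card_le_mul_card_image (f := (· ^ h)) T' (4 * p / (q * g)) ?_
      · calc g * (q * T'.card) ≤ g * (q * ((4 * p / (q * g)) * (T'.image (· ^ h)).card)) := by gcongr
          _ = q * g * (4 * p / (q * g)) * (T'.image (· ^ h)).card := by ring
          _ ≤ _ := Nat.mul_le_mul_right _ (Nat.mul_div_le _ _)
      · intro c hc
        obtain ⟨x₀, hx₀, rfl⟩ := Finset.mem_image.1 hc
        rw [Nat.le_div_iff_mul_le (Nat.mul_pos (by omega) hg)]
        rw [mul_comm, mul_assoc]
        have hx₀' := hT x₀ (Finset.mem_filter.1 hx₀).1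
        refine mul_card_fiber_le hk hgh hg hs ht hst hsh hgs hgt hq hqp hdvd hv hx₀'.1 _
          fun x hx => ?_
        rw [Finset.mem_filter, hT', Finset.mem_filter] at hx
        obtain ⟨h2, h3, h4⟩ := hT x hx.1.1
        exact ⟨hx.2, h2, h3, h4, hx.1.2⟩
    have h2 : (T'.image (· ^ h)).card ≤ g := by
      calc (T'.image (· ^ h)).card ≤ (nthRoots g (1 : ZMod p)).toFinset.card := by
            refine Finset.card_le_card fun c hc => ?_
            obtain ⟨x, hx, rfl⟩ := Finset.mem_image.1 hc
            rw [Multiset.mem_toFinset, mem_nthRoots hg]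
            change (x ^ h) ^ g = 1
            rw [← pow_mul, mul_comm, hgh]
            exact ZMod.pow_card_sub_one_eq_one (hT x (Finset.mem_filter.1 hx).1).1
        _ ≤ _ := (Multiset.toFinset_card_le _).trans (card_nthRoots _ _)
    have h3 : g * (q * T'.card) ≤ g * (4 * p) := by
      calc _ ≤ _ := h1
        _ ≤ 4 * p * g := Nat.mul_le_mul_left _ h2
        _ = _ := mul_comm _ _
    exact Nat.le_of_mul_le_mul_left h3 hg
  · rw [Finset.mem_filter, not_not] at hx
    exact ⟨(hT x hx.1).1, hx.2⟩

end

end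

section

variable {p : ℕ} [Fact p.Prime]

theorem sum_sum_norm_sq_eq {ι : Type*} [Fintype ι] {ψ : AddChar (ZMod p) ℂ} (hψ : ψ.IsPrimitive)
    (f g : ι → ZMod p) :
    ∑ a, ∑ b, ‖∑ i, ψ (a * f i + b * g i)‖ ^ 2 =
      (p : ℝ) ^ 2 * (Finset.univ.filter fun x : ι × ι => f x.1 = f x.2 ∧ g x.1 = g x.2).card := by
  classical
  have h1 : ∀ a b, ((‖∑ i, ψ (a * f i + b * g i)‖ ^ 2 : ℝ) : ℂ) =
      ∑ x : ι × ι, ψ (a * (f x.1 - f x.2)) * ψ (b * (g x.1 - g x.2)) := by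
    intro a b
    push_cast
    rw [← Complex.mul_conj', map_sum, Finset.sum_mul_sum, Fintype.sum_prod_type]
    refine Finset.sum_congr rfl fun i _ => Finset.sum_congr rfl fun j _ => ?_
    rw [← AddChar.map_neg_eq_conj, ← AddChar.map_add_eq_mul, ← AddChar.map_add_eq_mul]
    congr 1
    ring
  have h2 : ((∑ a, ∑ b, ‖∑ i, ψ (a * f i + b * g i)‖ ^ 2 : ℝ) : ℂ) =
      ∑ x : ι × ι, (∑ a, ψ (a * (f x.1 - f x.2))) * ∑ b, ψ (b * (g x.1 - g x.2)) := by
    simp_rw [Finset.sum_mul_sum]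
    conv_rhs => rw [Finset.sum_comm]
    push_cast
    refine Finset.sum_congr rfl fun a _ => ?_
    conv_rhs => rw [Finset.sum_comm]
    refine Finset.sum_congr rfl fun b _ => ?_
    rw [← h1]
    push_cast
    rfl
  have h3 : ∀ x : ι × ι, (∑ a, ψ (a * (f x.1 - f x.2))) * ∑ b, ψ (b * (g x.1 - g x.2)) =
      if f x.1 = f x.2 ∧ g x.1 = g x.2 then (p : ℂ) ^ 2 else 0 := by
    intro x
    rw [AddChar.sum_mulShift _ hψ, AddChar.sum_mulShift _ hψ, ZMod.card]
    simp_rw [sub_eq_zero]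
    by_cases ha : f x.1 = f x.2 <;> by_cases hb : g x.1 = g x.2 <;> simp [ha, hb, sq]
  have h4 : ((∑ a, ∑ b, ‖∑ i, ψ (a * f i + b * g i)‖ ^ 2 : ℝ) : ℂ) =
      (((p : ℝ) ^ 2 * (Finset.univ.filter fun x : ι × ι => f x.1 = f x.2 ∧ g x.1 = g x.2).card : ℝ)
        : ℂ) := by
    rw [h2, Finset.sum_congr rfl fun x _ => h3 x, Finset.sum_ite, Finset.sum_const,
      Finset.sum_const_zero, add_zero, nsmul_eq_mul]
    push_cast
    ring
  exact_mod_cast h4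

theorem sum_norm_sq_eq {ι : Type*} [Fintype ι] {ψ : AddChar (ZMod p) ℂ} (hψ : ψ.IsPrimitive)
    (g : ι → ZMod p) :
    ∑ b, ‖∑ i, ψ (b * g i)‖ ^ 2 =
      (p : ℝ) * (Finset.univ.filter fun x : ι × ι => g x.1 = g x.2).card := by
  have h := sum_sum_norm_sq_eq hψ (fun _ => 0) g
  have hp : (p : ℝ) ≠ 0 := by exact_mod_cast (Fact.out : p.Prime).ne_zero
  simp only [mul_zero, zero_add, true_and, Finset.sum_const, Finset.card_univ, ZMod.card,
    nsmul_eq_mul, sq (p : ℝ), mul_assoc] at h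
  exact mul_left_cancel₀ hp h

theorem norm_sum_subgroup_sq_le {ψ : AddChar (ZMod p) ℂ} (hψ : ψ.IsPrimitive)
    (H : Subgroup (ZMod p)ˣ) [Fintype H] {c : ZMod p} (hc : c ≠ 0) :
    ‖∑ z : H, ψ (c * (z : (ZMod p)ˣ))‖ ^ 2 ≤ p := by
  classical
  have h1 := sum_norm_sq_eq hψ fun z : H => ((z : (ZMod p)ˣ) : ZMod p)
  have h2 : (Finset.univ.filter fun x : H × H =>
      ((x.1 : (ZMod p)ˣ) : ZMod p) = ((x.2 : (ZMod p)ˣ) : ZMod p)).card = Fintype.card H := by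
    rw [show Fintype.card H = (Finset.univ : Finset H).diag.card by
      rw [Finset.diag_card, Finset.card_univ]]
    congr 1
    ext x
    rw [Finset.mem_filter, Finset.mem_diag]
    exact ⟨fun h => ⟨Finset.mem_univ _, Subtype.ext (Units.ext h.2)⟩,
      fun h => ⟨Finset.mem_univ _, by rw [h.2]⟩⟩
  rw [h2] at h1
  have h3 : ∑ u : H, ‖∑ z : H, ψ ((c * (u : (ZMod p)ˣ)) * (z : (ZMod p)ˣ))‖ ^ 2 ≤
      p * Fintype.card H := by
    rw [← h1]
    have hinj : Function.Injective fun u : H => c * ((u : (ZMod p)ˣ) : ZMod p) := by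
      intro u v huv
      have := mul_left_cancel₀ hc huv
      exact Subtype.ext (Units.ext this)
    rw [← Finset.sum_image (f := fun b => ‖∑ z : H, ψ (b * (z : (ZMod p)ˣ))‖ ^ 2)
      (hinj.injOn (s := ((Finset.univ : Finset H) : Set H)))]
    exact Finset.sum_le_sum_of_subset_of_nonneg (Finset.subset_univ _) fun _ _ _ => by positivity
  have h4 : ∀ u : H, ∑ z : H, ψ ((c * (u : (ZMod p)ˣ)) * (z : (ZMod p)ˣ)) =
      ∑ z : H, ψ (c * (z : (ZMod p)ˣ)) := by
    intro u
    refine Fintype.sum_equiv (Equiv.mulLeft u) _ _ fun z => ?_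
    simp [mul_assoc]
  simp_rw [h4] at h3
  rw [Finset.sum_const, Finset.card_univ, nsmul_eq_mul, mul_comm] at h3
  have h5 : (0 : ℝ) < Fintype.card H := by exact_mod_cast Fintype.card_pos
  exact le_of_mul_le_mul_right h3 h5

/-- The binomial exponential sum over the nonzero residues. -/
noncomputable def binomialSum (ψ : AddChar (ZMod p) ℂ) (k : ℕ) (a b : ZMod p) : ℂ :=
  ∑ x : (ZMod p)ˣ, ψ (a * (x : ZMod p) ^ k + b * x)

theorem norm_binomialSum_le (ψ : AddChar (ZMod p) ℂ) (k : ℕ) (a b : ZMod p) :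
    ‖binomialSum ψ k a b‖ ≤ p := by
  refine (norm_sum_le _ _).trans ?_
  simp only [AddChar.norm_apply, Finset.sum_const, Finset.card_univ, ZMod.card_units, nsmul_eq_mul,
    mul_one]
  exact_mod_cast Nat.sub_le _ _

theorem binomialSum_mul (ψ : AddChar (ZMod p) ℂ) (k : ℕ) (a b : ZMod p) (u : (ZMod p)ˣ) :
    binomialSum ψ k (a * (u : ZMod p) ^ k) (b * u) = binomialSum ψ k a b := by
  refine Fintype.sum_equiv (Equiv.mulLeft u) _ _ fun x => ?_
  simp only [Equiv.coe_mulLeft, Units.val_mul]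
  congr 1
  ring

theorem norm_binomialSum_le_of_gcd {ψ : AddChar (ZMod p) ℂ} (hψ : ψ.IsPrimitive) {k : ℕ}
    (hk : 1 ≤ k) {a b : ZMod p} (hab : a ≠ 0 ∨ b ≠ 0) :
    ‖binomialSum ψ k a b‖ ≤ Nat.gcd (k - 1) (p - 1) + p * √p / Nat.gcd (k - 1) (p - 1) := by
  classical
  set H : Subgroup (ZMod p)ˣ := (powMonoidHom (k - 1) : (ZMod p)ˣ →* (ZMod p)ˣ).ker with hH
  set d := Nat.gcd (k - 1) (p - 1) with hd
  have hp1 : 0 < p - 1 := Nat.sub_pos_of_lt (Fact.out : p.Prime).one_lt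
  have hd0 : 0 < d := Nat.gcd_pos_of_pos_right _ hp1
  have hHd : Fintype.card H = d := by
    rw [← Nat.card_eq_fintype_card, hH, IsCyclic.card_powMonoidHom_ker, Nat.card_eq_fintype_card,
      ZMod.card_units, Nat.gcd_comm]
  have hz : ∀ z : H, ((z : (ZMod p)ˣ) : ZMod p) ^ k = (z : (ZMod p)ˣ) := by
    intro z
    have h1 : ((z : (ZMod p)ˣ)) ^ (k - 1) = 1 := z.2
    have h2 := congrArg (Units.val) h1
    rw [Units.val_pow_eq_pow_val, Units.val_one] at h2
    rw [← Nat.sub_add_cancel hk, pow_succ, h2, one_mul]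
  set c : (ZMod p)ˣ → ZMod p := fun x => a * (x : ZMod p) ^ k + b * x with hc
  have h1 : (d : ℂ) * binomialSum ψ k a b =
      ∑ x : (ZMod p)ˣ, ∑ z : H, ψ (c x * (z : (ZMod p)ˣ)) := by
    rw [Finset.sum_comm]
    have h2 : ∀ z : H, ∑ x, ψ (c x * (z : (ZMod p)ˣ)) = binomialSum ψ k a b := by
      intro z
      rw [← binomialSum_mul ψ k a b z, hz]
      refine Finset.sum_congr rfl fun x _ => ?_
      congr 1
      simp only [hc]
      ring
    rw [Finset.sum_congr rfl fun z _ => h2 z, Finset.sum_const, Finset.card_univ, hHd,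
      nsmul_eq_mul]
  have h2 : ∀ x : (ZMod p)ˣ, ‖∑ z : H, ψ (c x * (z : (ZMod p)ˣ))‖ ≤
      (if c x = 0 then (d : ℝ) else 0) + √p := by
    intro x
    split_ifs with h
    · refine (norm_sum_le _ _).trans ?_
      simp only [AddChar.norm_apply, Finset.sum_const, Finset.card_univ, hHd, nsmul_eq_mul, mul_one]
      linarith [Real.sqrt_nonneg (p : ℝ)]
    · rw [zero_add]
      exact Real.le_sqrt_of_sq_le (norm_sum_subgroup_sq_le hψ H h)
  have h3 : (Finset.univ.filter fun x : (ZMod p)ˣ => c x = 0).card ≤ d := by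
    rw [← Finset.card_image_of_injective _ (Units.val_injective (α := ZMod p))]
    refine card_pow_eq_le_gcd (k - 1) (-b / a) hd0 _ fun x hx => ?_
    obtain ⟨u, hu, rfl⟩ := Finset.mem_image.1 hx
    refine ⟨u.ne_zero, ?_⟩
    have h4 : c u = 0 := (Finset.mem_filter.1 hu).2
    simp only [hc] at h4
    have ha : a ≠ 0 := by
      rintro rfl
      rw [zero_mul, zero_add] at h4
      exact mul_ne_zero (hab.resolve_left (not_not.2 rfl)) u.ne_zero h4
    rw [← Nat.sub_add_cancel hk, pow_succ] at h4
    rw [eq_div_iff ha]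
    refine mul_right_cancel₀ u.ne_zero ?_
    linear_combination h4
  have h4 : (d : ℝ) * ‖binomialSum ψ k a b‖ ≤ d * d + p * √p := by
    calc (d : ℝ) * ‖binomialSum ψ k a b‖ = ‖(d : ℂ) * binomialSum ψ k a b‖ := by
          rw [norm_mul, Complex.norm_natCast]
      _ ≤ ∑ x : (ZMod p)ˣ, ((if c x = 0 then (d : ℝ) else 0) + √p) := by
          rw [h1]
          exact (norm_sum_le _ _).trans (Finset.sum_le_sum fun x _ => h2 x)
      _ = (Finset.univ.filter fun x : (ZMod p)ˣ => c x = 0).card * d + (p - 1 : ℕ) * √p := by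
          rw [Finset.sum_add_distrib, Finset.sum_ite, Finset.sum_const, Finset.sum_const_zero,
            Finset.sum_const, Finset.card_univ, ZMod.card_units, nsmul_eq_mul, nsmul_eq_mul,
            add_zero]
      _ ≤ d * d + p * √p := by
          gcongr
          exact Nat.sub_le _ _
  have hd0' : (0 : ℝ) < d := by exact_mod_cast hd0
  calc ‖binomialSum ψ k a b‖ ≤ (d * d + p * √p) / d := by
        rw [le_div_iff₀ hd0', mul_comm]; exact h4
    _ = _ := by field_simp

end

section

variable {p : ℕ} [Fact p.Prime]

theorem units_pow_injective {k : ℕ} (hkp : Nat.Coprime k (p - 1)) :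
    Function.Injective fun u : (ZMod p)ˣ => u ^ k := by
  refine (Nat.Coprime.pow_left_bijective ?_).injective
  rw [Nat.card_eq_fintype_card, ZMod.card_units]
  exact hkp.symm

theorem card_eq_of_pow_add_pow_le {k R : ℕ} (hko : Odd k) (hkp : Nat.Coprime k (p - 1))
    (hR : ∀ v : ZMod p, v ≠ 0 → ∀ T : Finset (ZMod p),
      (∀ x ∈ T, x ≠ 0 ∧ x ≠ 1 ∧ x ^ k + (1 - x) ^ k = v) → T.card ≤ R)
    (i : (ZMod p)ˣ × (ZMod p)ˣ) :
    (Finset.univ.filter fun j : (ZMod p)ˣ × (ZMod p)ˣ =>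
      (i.1 : ZMod p) ^ k + (i.2 : ZMod p) ^ k = (j.1 : ZMod p) ^ k + (j.2 : ZMod p) ^ k ∧
        (i.1 : ZMod p) + i.2 = j.1 + j.2).card ≤
      R + if (i.1 : ZMod p) + i.2 = 0 then p - 1 else 0 := by
  classical
  set J := Finset.univ.filter fun j : (ZMod p)ˣ × (ZMod p)ˣ =>
      (i.1 : ZMod p) ^ k + (i.2 : ZMod p) ^ k = (j.1 : ZMod p) ^ k + (j.2 : ZMod p) ^ k ∧
        (i.1 : ZMod p) + i.2 = j.1 + j.2 with hJ
  have hinj : Set.InjOn (fun j : (ZMod p)ˣ × (ZMod p)ˣ => j.1) J := by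
    intro j hj j' hj' h
    have h1 : (i.1 : ZMod p) + i.2 = j.1 + j.2 := (Finset.mem_filter.1 hj).2.2
    have h2 : (i.1 : ZMod p) + i.2 = j'.1 + j'.2 := (Finset.mem_filter.1 hj').2.2
    have h3 : j.1 = j'.1 := h
    refine Prod.ext h3 (Units.ext ?_)
    rw [h1, h3] at h2
    exact add_left_cancel h2
  split_ifs with hc
  · rw [← Finset.card_image_of_injOn hinj]
    have := Finset.card_le_univ (J.image fun j => j.1)
    rw [ZMod.card_units] at this
    omega
  · set c := (i.1 : ZMod p) + i.2 with hcdef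
    have hinj' : Function.Injective fun u : (ZMod p)ˣ => (u : ZMod p) / c := by
      intro u v huv
      exact Units.ext ((div_left_inj' hc).1 huv)
    rw [add_zero, ← Finset.card_image_of_injOn hinj, ← Finset.card_image_of_injective _ hinj']
    refine hR (((i.1 : ZMod p) ^ k + (i.2 : ZMod p) ^ k) / c ^ k) ?_ _ ?_
    · refine div_ne_zero (fun h0 => hc ?_) (pow_ne_zero _ hc)
      have h1 : i.1 ^ k = (-i.2) ^ k := by
        refine Units.ext ?_
        rw [hko.neg_pow]
        push_cast
        exact eq_neg_of_add_eq_zero_left h0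
      rw [hcdef, units_pow_injective hkp h1]
      simp
    · intro x hx
      obtain ⟨u, hu, rfl⟩ := Finset.mem_image.1 hx
      obtain ⟨j, hj, rfl⟩ := Finset.mem_image.1 hu
      obtain ⟨-, h1, h2⟩ := Finset.mem_filter.1 hj
      have h3 : 1 - (j.1 : ZMod p) / c = j.2 / c := by
        rw [eq_div_iff hc, sub_mul, div_mul_cancel₀ _ hc, one_mul, hcdef, h2,
          add_sub_cancel_left]
      refine ⟨div_ne_zero j.1.ne_zero hc, fun h4 => ?_, ?_⟩
      · rw [h4, sub_self] at h3
        exact div_ne_zero j.2.ne_zero hc h3.symm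
      · rw [h3, div_pow, div_pow, ← add_div, h1]

theorem norm_binomialSum_pow_four_le {ψ : AddChar (ZMod p) ℂ} (hψ : ψ.IsPrimitive) {k R : ℕ}
    (hko : Odd k) (hkp : Nat.Coprime k (p - 1))
    (hR : ∀ v : ZMod p, v ≠ 0 → ∀ T : Finset (ZMod p),
      (∀ x ∈ T, x ≠ 0 ∧ x ≠ 1 ∧ x ^ k + (1 - x) ^ k = v) → T.card ≤ R)
    {a b : ZMod p} (hab : a ≠ 0 ∨ b ≠ 0) :
    ‖binomialSum ψ k a b‖ ^ 4 ≤ p ^ 3 * (1 + R) := by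
  classical
  have hp1 : 0 < p - 1 := Nat.sub_pos_of_lt (Fact.out : p.Prime).one_lt
  have h1 := sum_sum_norm_sq_eq hψ
    (fun x : (ZMod p)ˣ × (ZMod p)ˣ => (x.1 : ZMod p) ^ k + (x.2 : ZMod p) ^ k)
    (fun x : (ZMod p)ˣ × (ZMod p)ˣ => (x.1 : ZMod p) + (x.2 : ZMod p))
  have h2 : ∀ a b : ZMod p, ‖∑ x : (ZMod p)ˣ × (ZMod p)ˣ,
      ψ (a * ((x.1 : ZMod p) ^ k + (x.2 : ZMod p) ^ k) + b * ((x.1 : ZMod p) + (x.2 : ZMod p)))‖ ^ 2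
      = ‖binomialSum ψ k a b‖ ^ 4 := by
    intro a b
    have h3 : ∑ x : (ZMod p)ˣ × (ZMod p)ˣ,
        ψ (a * ((x.1 : ZMod p) ^ k + (x.2 : ZMod p) ^ k) + b * ((x.1 : ZMod p) + (x.2 : ZMod p))) =
        binomialSum ψ k a b ^ 2 := by
      rw [sq, binomialSum, Finset.sum_mul_sum, Fintype.sum_prod_type]
      refine Fintype.sum_congr _ _ fun i => Fintype.sum_congr _ _ fun j => ?_
      rw [← AddChar.map_add_eq_mul]
      congr 1
      ring
    rw [h3, norm_pow, ← pow_mul]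
  simp_rw [h2] at h1
  have h3 : (Finset.univ.filter fun x : ((ZMod p)ˣ × (ZMod p)ˣ) × ((ZMod p)ˣ × (ZMod p)ˣ) =>
      (x.1.1 : ZMod p) ^ k + (x.1.2 : ZMod p) ^ k = (x.2.1 : ZMod p) ^ k + (x.2.2 : ZMod p) ^ k ∧
        (x.1.1 : ZMod p) + x.1.2 = x.2.1 + x.2.2).card ≤ (p - 1) * ((p - 1) * (1 + R)) := by
    rw [Finset.card_filter, Fintype.sum_prod_type]
    simp_rw [← Finset.card_filter]
    refine (Finset.sum_le_sum fun i _ => card_eq_of_pow_add_pow_le hko hkp hR i).trans ?_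
    rw [Finset.sum_add_distrib, Finset.sum_const, Finset.card_univ, Fintype.card_prod,
      ZMod.card_units, Fintype.sum_prod_type]
    have h4 : ∀ u : (ZMod p)ˣ,
        (∑ v : (ZMod p)ˣ, if (u : ZMod p) + (v : ZMod p) = 0 then p - 1 else 0) = p - 1 := by
      intro u
      rw [Finset.sum_eq_single (-u)]
      · simp
      · intro v _ hv
        rw [if_neg]
        intro h0
        exact hv (Units.ext (by push_cast; exact eq_neg_of_add_eq_zero_right h0))
      · simp
    simp only [h4, Finset.sum_const, Finset.card_univ, ZMod.card_units, smul_eq_mul]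
    apply le_of_eq
    ring
  have h5 : ((p - 1 : ℕ) : ℝ) * ‖binomialSum ψ k a b‖ ^ 4 ≤
      ∑ a : ZMod p, ∑ b : ZMod p, ‖binomialSum ψ k a b‖ ^ 4 := by
    have hinj : Function.Injective fun u : (ZMod p)ˣ => (a * (u : ZMod p) ^ k, b * (u : ZMod p)) := by
      intro u v huv
      obtain ⟨h6, h7⟩ := Prod.mk.inj huv
      rcases hab with h | h
      · refine units_pow_injective hkp (Units.ext ?_)
        push_cast
        exact mul_left_cancel₀ h h6
      · exact Units.ext (mul_left_cancel₀ h h7)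
    calc ((p - 1 : ℕ) : ℝ) * ‖binomialSum ψ k a b‖ ^ 4
        = ∑ u : (ZMod p)ˣ, ‖binomialSum ψ k (a * (u : ZMod p) ^ k) (b * u)‖ ^ 4 := by
          simp_rw [binomialSum_mul]
          rw [Finset.sum_const, Finset.card_univ, ZMod.card_units, nsmul_eq_mul]
      _ = ∑ x ∈ Finset.univ.image fun u : (ZMod p)ˣ => (a * (u : ZMod p) ^ k, b * (u : ZMod p)),
            ‖binomialSum ψ k x.1 x.2‖ ^ 4 := by
          rw [Finset.sum_image hinj.injOn]
      _ ≤ ∑ x : ZMod p × ZMod p, ‖binomialSum ψ k x.1 x.2‖ ^ 4 :=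
          Finset.sum_le_sum_of_subset_of_nonneg (Finset.subset_univ _) fun _ _ _ => by positivity
      _ = _ := Fintype.sum_prod_type _
  have h6 : ((p - 1 : ℕ) : ℝ) * ‖binomialSum ψ k a b‖ ^ 4 ≤
      ((p - 1 : ℕ) : ℝ) * (p ^ 3 * (1 + R)) := by
    rw [h1] at h5
    calc ((p - 1 : ℕ) : ℝ) * ‖binomialSum ψ k a b‖ ^ 4 ≤ _ := h5
      _ ≤ (p : ℝ) ^ 2 * (((p - 1) * ((p - 1) * (1 + R)) : ℕ) : ℝ) := by
          gcongr
      _ = ((p - 1 : ℕ) : ℝ) * (p ^ 2 * (p - 1 : ℕ) * (1 + R)) := by push_cast; ring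
      _ ≤ ((p - 1 : ℕ) : ℝ) * (p ^ 2 * p * (1 + R)) := by
          gcongr
          exact Nat.sub_le _ _
      _ = _ := by ring
  exact le_of_mul_le_mul_left h6 (by exact_mod_cast hp1)

end

section

theorem exists_sixth_root_approx {p : ℕ} (hp : 6718464 ≤ p) :
    ∃ q : ℕ, 2 ≤ q ∧ 104976 * q ^ 6 ≤ p ∧ (p : ℝ) ^ ((1 : ℝ) / 6) ≤ 11 * q := by
  set P : ℕ → Prop := fun q => 104976 * q ^ 6 ≤ p with hP
  have h2 : P 2 := by simp only [hP]; omega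
  set q := Nat.findGreatest P p with hq
  have hq2 : 2 ≤ q := Nat.le_findGreatest (by omega) h2
  have h3 : P q := Nat.findGreatest_spec (m := 2) (by omega) h2
  refine ⟨q, hq2, h3, ?_⟩
  have h4 : p < 104976 * (q + 1) ^ 6 := by
    by_contra hlt
    have h5 : P (q + 1) := not_lt.1 hlt
    have h6 : q + 1 ≤ p := by
      have : q + 1 ≤ (q + 1) ^ 6 := Nat.le_self_pow (by norm_num) _
      simp only [hP] at h5
      omega
    have := Nat.le_findGreatest h6 h5
    omega
  have h7 : (p : ℝ) ≤ (11 * q) ^ 6 := by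
    have h8 : (p : ℝ) ≤ 104976 * ((q : ℝ) + 1) ^ 6 := by exact_mod_cast h4.le
    have h9 : (q : ℝ) + 1 ≤ 3 / 2 * q := by
      have : (2 : ℝ) ≤ q := by exact_mod_cast hq2
      linarith
    calc (p : ℝ) ≤ 104976 * ((q : ℝ) + 1) ^ 6 := h8
      _ ≤ 104976 * (3 / 2 * q) ^ 6 := by gcongr
      _ = (104976 * (3 / 2) ^ 6) * (q : ℝ) ^ 6 := by ring
      _ ≤ 11 ^ 6 * (q : ℝ) ^ 6 := by gcongr; norm_num
      _ = _ := by ring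
  calc (p : ℝ) ^ ((1 : ℝ) / 6) ≤ ((11 * q : ℝ) ^ 6) ^ ((1 : ℝ) / 6) := by gcongr
    _ = 11 * q := by
      rw [← Real.rpow_natCast, ← Real.rpow_mul (by positivity)]
      norm_num

/-- A power-saving bound for binomial exponential sums with a coprime exponent. -/
theorem norm_binomialSum_le_rpow {p : ℕ} [Fact p.Prime] {ψ : AddChar (ZMod p) ℂ}
    (hψ : ψ.IsPrimitive) {k : ℕ} (hk : 1 ≤ k) (hko : Odd k) (hkp : Nat.Coprime k (p - 1))
    {a b : ZMod p} (hab : a ≠ 0 ∨ b ≠ 0) :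
    ‖binomialSum ψ k a b‖ ≤ 6718464 * (Nat.gcd (k - 1) (p - 1) + (p : ℝ) ^ ((89 : ℝ) / 92)) := by
  have hp0 : (1 : ℝ) ≤ p := by exact_mod_cast (Fact.out : p.Prime).one_lt.le
  have hp0' : (0 : ℝ) < p := by linarith
  set d : ℝ := (Nat.gcd (k - 1) (p - 1) : ℝ) with hd
  have hd0 : 0 ≤ d := Nat.cast_nonneg _
  have hP1 : (1 : ℝ) ≤ (p : ℝ) ^ ((89 : ℝ) / 92) := Real.one_le_rpow hp0 (by norm_num)
  rcases Nat.lt_or_ge p 6718464 with hp | hp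
  · have h1 : (p : ℝ) ≤ 6718464 := by exact_mod_cast hp.le
    have := norm_binomialSum_le ψ k a b
    nlinarith
  rcases le_total d ((p : ℝ) ^ ((5 : ℝ) / 6)) with hdp | hdp
  · obtain ⟨q, hq, hqp, hqr⟩ := exists_sixth_root_approx hp
    have hq0 : (0 : ℝ) < q := by exact_mod_cast (by omega : 0 < q)
    have hmain := norm_binomialSum_pow_four_le (R := (4 * p + q * Nat.gcd (k - 1) (p - 1)) / q) hψ
      hko hkp (fun v hv T hT => by
        rw [Nat.le_div_iff_mul_le (by omega), mul_comm]
        exact mul_card_pow_add_pow_eq_le hk hkp hq hqp hv T hT) hab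
    have h56 : (p : ℝ) ^ ((5 : ℝ) / 6) * (p : ℝ) ^ ((1 : ℝ) / 6) = p := by
      rw [← Real.rpow_add hp0']; norm_num
    have h561 : (1 : ℝ) ≤ (p : ℝ) ^ ((5 : ℝ) / 6) := Real.one_le_rpow hp0 (by norm_num)
    have hR : (((4 * p + q * Nat.gcd (k - 1) (p - 1)) / q : ℕ) : ℝ) ≤
        45 * (p : ℝ) ^ ((5 : ℝ) / 6) := by
      refine Nat.cast_div_le.trans ?_
      push_cast
      rw [div_le_iff₀ hq0]
      rw [← hd]
      have : (p : ℝ) ≤ (p : ℝ) ^ ((5 : ℝ) / 6) * (11 * q) := by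
        calc (p : ℝ) = (p : ℝ) ^ ((5 : ℝ) / 6) * (p : ℝ) ^ ((1 : ℝ) / 6) := h56.symm
          _ ≤ _ := by gcongr
      nlinarith
    have h4 : ‖binomialSum ψ k a b‖ ^ 4 ≤ (3 * (p : ℝ) ^ ((23 : ℝ) / 24)) ^ 4 := by
      have h5 : ((p : ℝ) ^ ((23 : ℝ) / 24)) ^ 4 = (p : ℝ) ^ 3 * (p : ℝ) ^ ((5 : ℝ) / 6) := by
        rw [← Real.rpow_natCast, ← Real.rpow_natCast, ← Real.rpow_mul hp0'.le,
          ← Real.rpow_add hp0']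
        norm_num
      rw [mul_pow, h5]
      calc ‖binomialSum ψ k a b‖ ^ 4 ≤ _ := hmain
        _ ≤ (p : ℝ) ^ 3 * (81 * (p : ℝ) ^ ((5 : ℝ) / 6)) := by
          gcongr
          linarith
        _ = _ := by ring
    have h6 : ‖binomialSum ψ k a b‖ ≤ 3 * (p : ℝ) ^ ((23 : ℝ) / 24) :=
      (pow_le_pow_iff_left₀ (norm_nonneg _) (by positivity) (by norm_num)).1 h4
    have h7 : (p : ℝ) ^ ((23 : ℝ) / 24) ≤ (p : ℝ) ^ ((89 : ℝ) / 92) :=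
      Real.rpow_le_rpow_of_exponent_le hp0 (by norm_num)
    linarith
  · have h1 := norm_binomialSum_le_of_gcd hψ hk hab
    rw [← hd] at h1
    have hd1 : 0 < d := lt_of_lt_of_le (by positivity) hdp
    have h2 : p * √p / d ≤ (p : ℝ) ^ ((89 : ℝ) / 92) := by
      rw [div_le_iff₀ hd1]
      calc p * √p = (p : ℝ) ^ ((3 : ℝ) / 2) := by
            rw [Real.sqrt_eq_rpow, ← Real.rpow_one_add' hp0'.le (by norm_num)]; norm_num
        _ ≤ (p : ℝ) ^ ((89 : ℝ) / 92 + 5 / 6) :=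
            Real.rpow_le_rpow_of_exponent_le hp0 (by norm_num)
        _ = (p : ℝ) ^ ((89 : ℝ) / 92) * (p : ℝ) ^ ((5 : ℝ) / 6) := Real.rpow_add hp0' _ _
        _ ≤ _ := by gcongr
    linarith

end

section

theorem le_norm_stdAddChar_sub_one {p : ℕ} [NeZero p] {c : ZMod p} (hc : 2 * c.val ≤ p) :
    4 * (c.val : ℝ) / p ≤ ‖ZMod.stdAddChar c - 1‖ := by
  have hp : (0 : ℝ) < p := by exact_mod_cast Nat.pos_of_ne_zero (NeZero.ne p)
  have hc' : 2 * (c.val : ℝ) ≤ p := by exact_mod_cast hc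
  have h1 : ZMod.stdAddChar c = Complex.exp (Complex.I * ((2 * Real.pi * c.val / p : ℝ) : ℂ)) := by
    have h2 : c = ((c.val : ℤ) : ZMod p) := by simp
    conv_lhs => rw [h2]
    rw [ZMod.stdAddChar_coe]
    congr 1
    push_cast
    ring
  rw [h1, Complex.norm_exp_I_mul_ofReal_sub_one, Real.norm_eq_abs]
  have h3 := Real.mul_le_sin (x := 2 * Real.pi * c.val / p / 2) (by positivity) (by
    rw [div_div, div_le_div_iff₀ (by positivity) (by norm_num)]
    nlinarith [Real.pi_pos])
  refine le_trans ?_ (le_abs_self _)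
  calc 4 * (c.val : ℝ) / p = 2 * (2 / Real.pi * (2 * Real.pi * c.val / p / 2)) := by
        field_simp; ring
    _ ≤ _ := by gcongr

theorem norm_stdAddChar_neg_sub_one {p : ℕ} [NeZero p] (c : ZMod p) :
    ‖ZMod.stdAddChar (-c) - 1‖ = ‖ZMod.stdAddChar c - 1‖ := by
  rw [AddChar.map_neg_eq_conj, ← Complex.norm_conj, map_sub, Complex.conj_conj, map_one]

theorem two_div_norm_stdAddChar_sub_one_le {p : ℕ} [NeZero p] {c : ZMod p} (hc : c ≠ 0) :
    2 / ‖ZMod.stdAddChar c - 1‖ ≤ (p : ℝ) / 2 * ((c.val : ℝ)⁻¹ + ((-c).val : ℝ)⁻¹) := by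
  have hp : (0 : ℝ) < p := by exact_mod_cast Nat.pos_of_ne_zero (NeZero.ne p)
  have key : ∀ e : ZMod p, e ≠ 0 → 2 * e.val ≤ p →
      2 / ‖ZMod.stdAddChar e - 1‖ ≤ (p : ℝ) / 2 * (e.val : ℝ)⁻¹ := by
    intro e he h
    have he0 : (0 : ℝ) < e.val := by
      exact_mod_cast Nat.pos_of_ne_zero fun h0 => he ((ZMod.val_eq_zero e).1 h0)
    calc 2 / ‖ZMod.stdAddChar e - 1‖ ≤ 2 / (4 * (e.val : ℝ) / p) := by
          gcongr
          exact le_norm_stdAddChar_sub_one h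
      _ = _ := by field_simp; ring
  have h0 : ∀ e : ZMod p, 0 ≤ (p : ℝ) / 2 * (e.val : ℝ)⁻¹ := fun e => by positivity
  rw [mul_add]
  rcases le_total (2 * c.val) p with h | h
  · linarith [key c hc h, h0 (-c)]
  · have h2 : 2 * (-c).val ≤ p := by
      have : NeZero c := ⟨hc⟩
      rw [ZMod.val_neg_of_ne_zero]
      omega
    have := key (-c) (neg_ne_zero.2 hc) h2
    rw [norm_stdAddChar_neg_sub_one] at this
    linarith [h0 c]

theorem sum_two_div_norm_stdAddChar_sub_one_le {p : ℕ} [NeZero p] :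
    ∑ c ∈ Finset.univ.erase (0 : ZMod p), 2 / ‖ZMod.stdAddChar c - 1‖ ≤
      p * (1 + Real.log p) := by
  classical
  set T := Finset.univ.erase (0 : ZMod p) with hT
  have h1 : ∑ c ∈ T, (c.val : ℝ)⁻¹ ≤ 1 + Real.log p := by
    have h2 : ∑ c ∈ T, (c.val : ℝ)⁻¹ = ∑ m ∈ T.image ZMod.val, (m : ℝ)⁻¹ := by
      rw [Finset.sum_image (ZMod.val_injective p).injOn]
    rw [h2]
    calc ∑ m ∈ T.image ZMod.val, (m : ℝ)⁻¹ ≤ ∑ m ∈ Finset.Icc 1 p, (m : ℝ)⁻¹ := by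
          refine Finset.sum_le_sum_of_subset_of_nonneg ?_ fun _ _ _ => by positivity
          intro m hm
          obtain ⟨c, hc, rfl⟩ := Finset.mem_image.1 hm
          rw [Finset.mem_Icc]
          refine ⟨Nat.pos_of_ne_zero fun h0 => ?_, (ZMod.val_lt c).le⟩
          exact (Finset.mem_erase.1 hc).1 ((ZMod.val_eq_zero c).1 h0)
      _ = ((harmonic p : ℚ) : ℝ) := by
          rw [harmonic_eq_sum_Icc]; push_cast; rfl
      _ ≤ _ := harmonic_le_one_add_log p
  have h3 : ∑ c ∈ T, ((-c).val : ℝ)⁻¹ = ∑ c ∈ T, (c.val : ℝ)⁻¹ :=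
    Finset.sum_nbij' (fun c => -c) (fun c => -c) (by simp [hT]) (by simp [hT]) (by simp) (by simp)
      (by simp)
  calc ∑ c ∈ T, 2 / ‖ZMod.stdAddChar c - 1‖
      ≤ ∑ c ∈ T, (p : ℝ) / 2 * ((c.val : ℝ)⁻¹ + ((-c).val : ℝ)⁻¹) :=
        Finset.sum_le_sum fun c hc =>
          two_div_norm_stdAddChar_sub_one_le (Finset.mem_erase.1 hc).1
    _ = (p : ℝ) * ∑ c ∈ T, (c.val : ℝ)⁻¹ := by
        rw [← Finset.mul_sum, Finset.sum_add_distrib, h3]; ring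
    _ ≤ _ := by gcongr

theorem Iclass_eq_image {p n j : ℕ} (hn : 2 ≤ n) (hnp : n < p) (hj : j ≤ n - 1) :
    ∃ s t : ℕ, s ≤ 1 ∧ s ≤ t ∧ n * t ≤ p + n ∧ p ≤ n * (t + 1) ∧
      Iclass p n j = (Finset.Ico s t).image fun l => j + n * l := by
  refine ⟨if j = 0 then 1 else 0, (p - 1 - j) / n + 1, by split_ifs <;> omega,
    by split_ifs <;> simp, ?_, ?_, ?_⟩
  · have := Nat.mul_div_le (p - 1 - j) n
    rw [mul_add]; omega
  · have := Nat.lt_mul_div_succ (p - 1 - j) (by omega : 0 < n)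
    rw [mul_add, mul_one]
    omega
  · ext x
    rw [Iclass, Finset.mem_filter, Finset.mem_Icc, Finset.mem_image]
    constructor
    · rintro ⟨⟨h1, h2⟩, rfl⟩
      refine ⟨x / n, ?_, Nat.mod_add_div x n⟩
      have h3 := Nat.mod_add_div x n
      rw [Finset.mem_Ico]
      constructor
      · split_ifs with h
        · refine Nat.pos_of_ne_zero fun h0 => ?_
          rw [h0, h] at h3
          omega
        · exact Nat.zero_le _
      · rw [Nat.lt_succ_iff, Nat.le_div_iff_mul_le (by omega), mul_comm]
        omega
    · rintro ⟨l, hl, rfl⟩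
      rw [Finset.mem_Ico, Nat.lt_succ_iff, Nat.le_div_iff_mul_le (by omega), mul_comm] at hl
      refine ⟨⟨?_, by omega⟩, ?_⟩
      · by_cases h : j = 0
        · rw [if_pos h] at hl
          have : 0 < n * l := Nat.mul_pos (by omega) hl.1
          omega
        · omega
      · rw [Nat.add_mul_mod_self_left]
        exact Nat.mod_eq_of_lt (by omega)

theorem abs_card_Iclass_sub_le {p n j : ℕ} (hn : 2 ≤ n) (hnp : n < p) (hj : j ≤ n - 1) :
    |((Iclass p n j).card : ℝ) - p / n| ≤ 2 := by
  obtain ⟨s, t, hs, hst, h1, h2, h3⟩ := Iclass_eq_image hn hnp hj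
  have hn0 : (0 : ℝ) < n := by exact_mod_cast (by omega : 0 < n)
  have hcard : (Iclass p n j).card = t - s := by
    rw [h3, Finset.card_image_of_injective, Nat.card_Ico]
    intro a b hab
    exact Nat.eq_of_mul_eq_mul_left (by omega) (Nat.add_left_cancel hab)
  rw [hcard, Nat.cast_sub hst]
  have hs' : (s : ℝ) ≤ 1 := by exact_mod_cast hs
  have h1' : (n : ℝ) * t ≤ p + n := by exact_mod_cast h1
  have h2' : (p : ℝ) ≤ n * (t + 1) := by exact_mod_cast h2
  have h4 : (p : ℝ) / n ≤ t + 1 := by rw [div_le_iff₀ hn0]; linarith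
  have h5 : (t : ℝ) - 1 ≤ p / n := by rw [le_div_iff₀ hn0]; linarith
  have h6 : (0 : ℝ) ≤ s := Nat.cast_nonneg _
  rw [abs_le]
  constructor <;> linarith

theorem norm_sum_Iclass_le {p n j : ℕ} [Fact p.Prime] (hn : 2 ≤ n) (hnp : n < p) (hj : j ≤ n - 1)
    {c : ZMod p} (hc : c ≠ 0) :
    ‖∑ x ∈ Iclass p n j, ZMod.stdAddChar (c * (x : ZMod p))‖ ≤
      2 / ‖ZMod.stdAddChar (c * (n : ZMod p)) - 1‖ := by
  obtain ⟨s, t, -, hst, -, -, h3⟩ := Iclass_eq_image hn hnp hj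
  have hn0 : (n : ZMod p) ≠ 0 := by
    rw [Ne, ZMod.natCast_eq_zero_iff]
    exact fun h => absurd (Nat.le_of_dvd (by omega) h) (by omega)
  set ζ : ℂ := ZMod.stdAddChar (c * (n : ZMod p)) with hζ
  have hζ1 : ζ ≠ 1 := by
    intro h
    exact mul_ne_zero hc hn0 (ZMod.injective_stdAddChar (by rw [AddChar.map_zero_eq_one]; exact h))
  have hζn : ‖ζ‖ = 1 := AddChar.norm_apply _ _
  rw [h3, Finset.sum_image (fun a _ b _ hab =>
    Nat.eq_of_mul_eq_mul_left (by omega) (Nat.add_left_cancel hab))]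
  have h4 : ∀ l, ZMod.stdAddChar (c * ((j + n * l : ℕ) : ZMod p)) =
      ZMod.stdAddChar (c * (j : ZMod p)) * ζ ^ l := by
    intro l
    rw [hζ, ← AddChar.map_nsmul_eq_pow, ← AddChar.map_add_eq_mul]
    congr 1
    push_cast
    rw [nsmul_eq_mul]
    ring
  rw [Finset.sum_congr rfl fun l _ => h4 l, ← Finset.mul_sum, norm_mul, AddChar.norm_apply, one_mul,
    geom_sum_Ico hζ1 hst, norm_div]
  gcongr
  refine (norm_sub_le _ _).trans ?_
  rw [norm_pow, norm_pow, hζn, one_pow, one_pow]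
  norm_num

theorem sum_norm_sum_Iclass_le {p n j : ℕ} [Fact p.Prime] (hn : 2 ≤ n) (hnp : n < p)
    (hj : j ≤ n - 1) :
    ∑ c : ZMod p, ‖∑ x ∈ Iclass p n j, ZMod.stdAddChar (c * (x : ZMod p))‖ ≤
      p * (2 + Real.log p) := by
  classical
  have hn0 : (n : ZMod p) ≠ 0 := by
    rw [Ne, ZMod.natCast_eq_zero_iff]
    exact fun h => absurd (Nat.le_of_dvd (by omega) h) (by omega)
  rw [← Finset.add_sum_erase _ _ (Finset.mem_univ (0 : ZMod p))]
  have h1 : ‖∑ x ∈ Iclass p n j, ZMod.stdAddChar ((0 : ZMod p) * (x : ZMod p))‖ ≤ p := by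
    refine (norm_sum_le _ _).trans ?_
    simp only [AddChar.norm_apply, Finset.sum_const, nsmul_eq_mul, mul_one]
    have : (Iclass p n j).card ≤ p := by
      refine (Finset.card_filter_le _ _).trans ?_
      rw [Nat.card_Icc]; omega
    exact_mod_cast this
  have h2 : ∑ c ∈ Finset.univ.erase (0 : ZMod p),
      ‖∑ x ∈ Iclass p n j, ZMod.stdAddChar (c * (x : ZMod p))‖ ≤ p * (1 + Real.log p) := by
    calc _ ≤ ∑ c ∈ Finset.univ.erase (0 : ZMod p),
          2 / ‖ZMod.stdAddChar (c * (n : ZMod p)) - 1‖ :=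
          Finset.sum_le_sum fun c hc => norm_sum_Iclass_le hn hnp hj (Finset.mem_erase.1 hc).1
      _ = ∑ c ∈ Finset.univ.erase (0 : ZMod p), 2 / ‖ZMod.stdAddChar c - 1‖ :=
          Finset.sum_nbij' (fun c => c * (n : ZMod p)) (fun c => c * (n : ZMod p)⁻¹)
            (by simp [hn0]) (by simp [hn0]) (by simp [hn0]) (by simp [hn0]) (by simp)
      _ ≤ _ := sum_two_div_norm_stdAddChar_sub_one_le
  calc _ ≤ (p : ℝ) + p * (1 + Real.log p) := add_le_add h1 h2
    _ = _ := by ring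

end

section

theorem natCast_mul_indicator_eq_sum {p : ℕ} [Fact p.Prime] {Y : Finset ℕ}
    (hY : ∀ m ∈ Y, m < p) (y : ZMod p) :
    (p : ℂ) * (if y.val ∈ Y then 1 else 0) =
      ∑ a : ZMod p, (∑ m ∈ Y, ZMod.stdAddChar (-a * (m : ZMod p))) * ZMod.stdAddChar (a * y) := by
  have h1 : ∀ a : ZMod p,
      (∑ m ∈ Y, ZMod.stdAddChar (-a * (m : ZMod p))) * ZMod.stdAddChar (a * y) =
        ∑ m ∈ Y, ZMod.stdAddChar (a * (y - (m : ZMod p))) := by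
    intro a
    rw [Finset.sum_mul]
    refine Finset.sum_congr rfl fun m _ => ?_
    rw [← AddChar.map_add_eq_mul]
    congr 1
    ring
  rw [Finset.sum_congr rfl fun a _ => h1 a, Finset.sum_comm]
  have h2 : ∀ m ∈ Y, ∑ a : ZMod p, ZMod.stdAddChar (a * (y - (m : ZMod p))) =
      if m = y.val then (p : ℂ) else 0 := by
    intro m hm
    rw [AddChar.sum_mulShift _ (ZMod.isPrimitive_stdAddChar p), ZMod.card]
    have h3 : y = (m : ZMod p) ↔ m = y.val := by
      constructor
      · rintro rfl
        exact (ZMod.val_cast_of_lt (hY m hm)).symm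
      · rintro rfl
        simp
    simp only [sub_eq_zero, h3, Nat.cast_ite, Nat.cast_zero]
  rw [Finset.sum_congr rfl h2, Finset.sum_ite_eq']
  split_ifs <;> simp

theorem sq_mul_card_eq_sum_binomialSum {p : ℕ} [Fact p.Prime] {X Y : Finset ℕ}
    (hX : ∀ m ∈ X, m < p) (hY : ∀ m ∈ Y, m < p) (k : ℕ) (α : ZMod p) :
    (p : ℂ) ^ 2 * ((Finset.univ.filter fun u : (ZMod p)ˣ =>
        (u : ZMod p).val ∈ X ∧ (α * (u : ZMod p) ^ k).val ∈ Y).card : ℂ) =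
      ∑ a : ZMod p, ∑ b : ZMod p, (∑ m ∈ Y, ZMod.stdAddChar (-a * (m : ZMod p))) *
        (∑ m ∈ X, ZMod.stdAddChar (-b * (m : ZMod p))) *
          binomialSum ZMod.stdAddChar k (a * α) b := by
  have h1 : (p : ℂ) ^ 2 * ((Finset.univ.filter fun u : (ZMod p)ˣ =>
        (u : ZMod p).val ∈ X ∧ (α * (u : ZMod p) ^ k).val ∈ Y).card : ℂ) =
      ∑ u : (ZMod p)ˣ, (p * (if (α * (u : ZMod p) ^ k).val ∈ Y then 1 else 0)) *
        (p * (if (u : ZMod p).val ∈ X then 1 else 0) : ℂ) := by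
    rw [Finset.card_filter, Nat.cast_sum, Finset.mul_sum]
    refine Finset.sum_congr rfl fun u _ => ?_
    split_ifs <;> simp_all [sq]
  rw [h1]
  simp only [natCast_mul_indicator_eq_sum hX, natCast_mul_indicator_eq_sum hY]
  rw [Finset.sum_congr rfl fun u _ => Finset.sum_mul_sum _ _ _ _]
  rw [Finset.sum_comm]
  refine Finset.sum_congr rfl fun a _ => ?_
  rw [Finset.sum_comm]
  refine Finset.sum_congr rfl fun b _ => ?_
  rw [binomialSum, Finset.mul_sum]
  refine Finset.sum_congr rfl fun u _ => ?_
  rw [mul_mul_mul_comm, ← AddChar.map_add_eq_mul]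
  congr 2
  ring

theorem abs_sq_mul_card_sub_le {p : ℕ} [Fact p.Prime] {X Y : Finset ℕ}
    (hX : ∀ m ∈ X, m < p) (hY : ∀ m ∈ Y, m < p) (k : ℕ) {α : ZMod p} {B L : ℝ}
    (hB0 : 0 ≤ B)
    (hB : ∀ a b : ZMod p, a ≠ 0 ∨ b ≠ 0 → ‖binomialSum ZMod.stdAddChar k (a * α) b‖ ≤ B)
    (hXL : ∑ c : ZMod p, ‖∑ x ∈ X, ZMod.stdAddChar (c * (x : ZMod p))‖ ≤ L)
    (hYL : ∑ c : ZMod p, ‖∑ x ∈ Y, ZMod.stdAddChar (c * (x : ZMod p))‖ ≤ L) :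
    |(p : ℝ) ^ 2 * ((Finset.univ.filter fun u : (ZMod p)ˣ =>
        (u : ZMod p).val ∈ X ∧ (α * (u : ZMod p) ^ k).val ∈ Y).card : ℝ) -
      X.card * Y.card * (p - 1)| ≤ B * L ^ 2 := by
  classical
  set N := (Finset.univ.filter fun u : (ZMod p)ˣ =>
        (u : ZMod p).val ∈ X ∧ (α * (u : ZMod p) ^ k).val ∈ Y).card with hN
  set EX : ZMod p → ℂ := fun c => ∑ x ∈ X, ZMod.stdAddChar (c * (x : ZMod p)) with hEX
  set EY : ZMod p → ℂ := fun c => ∑ x ∈ Y, ZMod.stdAddChar (c * (x : ZMod p)) with hEY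
  have h0 : (0 : ℝ) ≤ L := (Finset.sum_nonneg fun _ _ => norm_nonneg _).trans hXL
  have hp1 : 1 ≤ p := (Fact.out : p.Prime).one_le
  have h1 : (p : ℂ) ^ 2 * N = ∑ q : ZMod p × ZMod p,
      EY (-q.1) * EX (-q.2) * binomialSum ZMod.stdAddChar k (q.1 * α) q.2 := by
    rw [hN, sq_mul_card_eq_sum_binomialSum hX hY, Fintype.sum_prod_type]
  have h2 : EY (-(0 : ZMod p)) * EX (-(0 : ZMod p)) *
      binomialSum ZMod.stdAddChar k ((0 : ZMod p) * α) 0 = X.card * Y.card * (p - 1) := by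
    simp only [hEX, hEY, binomialSum, neg_zero, zero_mul, add_zero, AddChar.map_zero_eq_one,
      Finset.sum_const, nsmul_eq_mul, mul_one, Finset.card_univ, ZMod.card_units_eq_totient,
      Nat.totient_prime (Fact.out : p.Prime)]
    rw [Nat.cast_sub hp1, Nat.cast_one]
    ring
  have hneg : ∀ F : ZMod p → ℂ, ∑ c, ‖F (-c)‖ = ∑ c, ‖F c‖ := fun F =>
    Equiv.sum_comp (Equiv.neg (ZMod p)) fun c => ‖F c‖
  have h3 : (((p : ℝ) ^ 2 * N - X.card * Y.card * (p - 1) : ℝ) : ℂ) =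
      ∑ q ∈ Finset.univ.erase ((0, 0) : ZMod p × ZMod p),
        EY (-q.1) * EX (-q.2) * binomialSum ZMod.stdAddChar k (q.1 * α) q.2 := by
    push_cast
    rw [h1, ← Finset.add_sum_erase _ _ (Finset.mem_univ ((0, 0) : ZMod p × ZMod p)), h2]
    ring
  rw [← Real.norm_eq_abs, ← Complex.norm_real, h3]
  calc _ ≤ ∑ q ∈ Finset.univ.erase ((0, 0) : ZMod p × ZMod p),
        ‖EY (-q.1)‖ * ‖EX (-q.2)‖ * B := by
        refine norm_sum_le_of_le _ fun q hq => ?_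
        rw [norm_mul, norm_mul]
        gcongr
        refine hB _ _ ?_
        by_contra! h
        exact (Finset.mem_erase.1 hq).1 (Prod.ext h.1 h.2)
    _ ≤ ∑ q : ZMod p × ZMod p, ‖EY (-q.1)‖ * ‖EX (-q.2)‖ * B :=
        Finset.sum_le_sum_of_subset_of_nonneg (Finset.erase_subset _ _)
          fun _ _ _ => by positivity
    _ = (∑ c, ‖EY c‖) * (∑ c, ‖EX c‖) * B := by
        rw [← Finset.sum_mul, Fintype.sum_prod_type, ← hneg EY, ← hneg EX, Finset.sum_mul_sum]
    _ ≤ L * L * B := by gcongr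
    _ = B * L ^ 2 := by ring

theorem card_image_fmap_inter_Iclass {p n k : ℕ} [Fact p.Prime] {A : ℤ} (hA : ¬ (p : ℤ) ∣ A)
    (hkp : Nat.Coprime k (p - 1)) (i j : ℕ) :
    (((Iclass p n i).image (fmap p A k)) ∩ Iclass p n j).card =
      (Finset.univ.filter fun u : (ZMod p)ˣ => (u : ZMod p).val ∈ Iclass p n i ∧
        ((A : ZMod p) * (u : ZMod p) ^ k).val ∈ Iclass p n j).card := by
  classical
  have hA0 : (A : ZMod p) ≠ 0 := by rwa [Ne, ZMod.intCast_zmod_eq_zero_iff_dvd]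
  rw [← Finset.card_image_of_injective (f := fun u : (ZMod p)ˣ =>
    ((A : ZMod p) * (u : ZMod p) ^ k).val)]
  · congr 1
    ext y
    simp only [Finset.mem_inter, Finset.mem_image, Finset.mem_filter, Finset.mem_univ, true_and]
    constructor
    · rintro ⟨⟨x, hx, rfl⟩, hy⟩
      have hx' := Finset.mem_Icc.1 (Finset.mem_filter.1 hx).1
      have hval : ((x : ZMod p)).val = x := ZMod.val_cast_of_lt (by omega)
      have hx0 : (x : ZMod p) ≠ 0 := fun h => by
        rw [h, ZMod.val_zero] at hval
        omega
      refine ⟨Units.mk0 (x : ZMod p) hx0, ⟨?_, ?_⟩, rfl⟩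
      · rwa [Units.val_mk0, hval]
      · exact hy
    · rintro ⟨u, ⟨hu, hy⟩, rfl⟩
      refine ⟨⟨(u : ZMod p).val, hu, ?_⟩, hy⟩
      rw [fmap, ZMod.natCast_zmod_val]
  · intro u v huv
    have h1 := mul_left_cancel₀ hA0 (ZMod.val_injective p huv)
    exact units_pow_injective hkp (Units.ext (by simpa using h1))

theorem abs_mul_mul_sub_div_sub_le {p n u v : ℝ} (hp : 1 ≤ p) (hn : 0 < n) (hu0 : 0 ≤ u)
    (hv0 : 0 ≤ v) (hup : u ≤ p) (hvp : v ≤ p) (hn1 : 1 ≤ n) (hu : |u - p / n| ≤ 2)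
    (hv : |v - p / n| ≤ 2) : |u * v * (p - 1) / p ^ 2 - p / n ^ 2| ≤ 5 := by
  have hp0 : 0 < p := by linarith
  have e : u * v * (p - 1) / p ^ 2 - p / n ^ 2 =
      (u - p / n) * (v / p) + (v - p / n) * (1 / n) - (u / p) * (v / p) := by
    field_simp
    ring
  have h1 : |v / p| ≤ 1 := by
    rw [abs_of_nonneg (by positivity)]; exact (div_le_one hp0).2 hvp
  have h2 : |1 / n| ≤ 1 := by
    rw [abs_of_nonneg (by positivity)]; exact (div_le_one hn).2 hn1
  have h3 : |u / p| ≤ 1 := by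
    rw [abs_of_nonneg (by positivity)]; exact (div_le_one hp0).2 hup
  rw [e]
  calc _ ≤ |u - p / n| * |v / p| + |v - p / n| * |1 / n| + |u / p| * |v / p| := by
        rw [← abs_mul, ← abs_mul, ← abs_mul]
        exact (abs_sub _ _).trans (add_le_add_left (abs_add_le _ _) _)
    _ ≤ 2 * 1 + 2 * 1 + 1 * 1 := by gcongr
    _ = 5 := by norm_num

end

theorem stmt_0 :
    ∃ C : ℝ, 0 < C ∧
      ∀ (p n k : ℕ) (A : ℤ), p.Prime → Odd p → 2 ≤ n → n < p →
        2 * |A| < (p : ℤ) → ¬ (p : ℤ) ∣ A → 1 ≤ k → k < p - 1 → Nat.gcd k (p - 1) = 1 →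
        ∀ i j : ℕ, i ≤ n - 1 → j ≤ n - 1 →
          |((((Iclass p n i).image (fmap p A k)) ∩ Iclass p n j).card : ℝ)
              - (p : ℝ) / (n : ℝ) ^ 2| ≤
            C * ((Nat.gcd (k - 1) (p - 1) : ℝ) * Real.log p ^ 2 +
              (p : ℝ) ^ ((89 : ℝ) / 92) * Real.log p ^ 2) := by
  refine ⟨9 * 6718464 + 5, by norm_num, ?_⟩
  intro p n k A hp hpo hn hnp _ hA hk hkp hco i j hi hj
  have : Fact p.Prime := ⟨hp⟩
  have hp3 : 3 ≤ p := by omega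
  have hp3' : (3 : ℝ) ≤ p := by exact_mod_cast hp3
  have hp0 : (0 : ℝ) < p := by linarith
  have hA0 : (A : ZMod p) ≠ 0 := by rwa [Ne, ZMod.intCast_zmod_eq_zero_iff_dvd]
  have hlog : 1 ≤ Real.log p := by
    rw [Real.le_log_iff_exp_le hp0]
    linarith [Real.exp_one_lt_d9]
  have hd : (1 : ℝ) ≤ Nat.gcd (k - 1) (p - 1) := by
    exact_mod_cast Nat.gcd_pos_of_pos_right _ (by omega)
  have hko : Odd k := by
    rw [← Nat.not_even_iff_odd]
    intro hke
    have h2 : 2 ∣ Nat.gcd k (p - 1) :=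
      Nat.dvd_gcd hke.two_dvd (by obtain ⟨m, hm⟩ := hpo; exact ⟨m, by omega⟩)
    rw [hco] at h2
    omega
  have hlt : ∀ j, ∀ m ∈ Iclass p n j, m < p := fun j m hm => by
    have := Finset.mem_Icc.1 (Finset.mem_filter.1 hm).1
    omega
  have hcard : ∀ j, ((Iclass p n j).card : ℝ) ≤ p := fun j => by
    have : (Iclass p n j).card ≤ p := by
      refine (Finset.card_filter_le _ _).trans ?_
      rw [Nat.card_Icc]; omega
    exact_mod_cast this
  set d : ℝ := (Nat.gcd (k - 1) (p - 1) : ℝ)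
  set P : ℝ := (p : ℝ) ^ ((89 : ℝ) / 92)
  have hP0 : 0 ≤ P := by positivity
  have key := abs_sq_mul_card_sub_le (hlt i) (hlt j) k (α := (A : ZMod p))
    (B := 6718464 * (d + P)) (L := p * (2 + Real.log p)) (by positivity)
    (fun a b hab => norm_binomialSum_le_rpow (ZMod.isPrimitive_stdAddChar p) hk hko hco
      (hab.imp_left fun h => mul_ne_zero h hA0))
    (sum_norm_sum_Iclass_le hn hnp hi) (sum_norm_sum_Iclass_le hn hnp hj)
  rw [← card_image_fmap_inter_Iclass hA hco] at key
  set N : ℝ := ((((Iclass p n i).image (fmap p A k)) ∩ Iclass p n j).card : ℝ)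
  have hn1 : (1 : ℝ) ≤ n := by exact_mod_cast (by omega : 1 ≤ n)
  have hmain := abs_mul_mul_sub_div_sub_le (p := p) (n := n) (by linarith) (by linarith)
    (Nat.cast_nonneg _) (Nat.cast_nonneg _) (hcard i) (hcard j) hn1
    (abs_card_Iclass_sub_le hn hnp hi) (abs_card_Iclass_sub_le hn hnp hj)
  set M : ℝ := ((Iclass p n i).card : ℝ) * (Iclass p n j).card * (p - 1)
  have hN : |N - M / p ^ 2| ≤ 6718464 * (d + P) * (2 + Real.log p) ^ 2 := by
    have e : N - M / p ^ 2 = (p ^ 2 * N - M) / p ^ 2 := by field_simp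
    rw [e, abs_div, abs_of_pos (by positivity : (0 : ℝ) < p ^ 2), div_le_iff₀ (by positivity)]
    calc _ ≤ _ := key
      _ = _ := by ring
  have hl : (2 + Real.log p) ^ 2 ≤ 9 * Real.log p ^ 2 := by nlinarith
  have hl1 : (1 : ℝ) ≤ Real.log p ^ 2 := by nlinarith
  calc |N - p / (n : ℝ) ^ 2| ≤ |N - M / p ^ 2| + |M / p ^ 2 - p / (n : ℝ) ^ 2| :=
        abs_sub_le _ _ _
    _ ≤ 6718464 * (d + P) * (9 * Real.log p ^ 2) + 5 * ((d + P) * Real.log p ^ 2) := by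
        refine add_le_add (hN.trans (by gcongr)) (hmain.trans ?_)
        nlinarith [mul_le_mul (by linarith : 1 ≤ d + P) hl1 zero_le_one (by linarith)]
    _ = _ := by ring
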